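/- arXiv:2406.00966 — 8 statements merged into one kernel-verified Lean document; each statement's English description precedes it below -/
import Mathlib

section
/- Let U be a finite set of size N, let M ⊆ U be a subset of size K, and write p = K/N. If S is a uniformly random subset of U of size n (i.e., drawn uniformly among all n-element subsets), then for every real w ≥ 0, the probability that |S ∩ M| ≥ (p + w)·n is at most exp(-2·w²·n). Equivalently, the number of n-element subsets S of U with |S ∩ M| ≥ (p + w)·n is at most exp(-2·w²·n) · C(N, n). -/
open Finset in
lemma aux_desc (K N j : ℕ) (h : K ≤ N) :
    K.descFactorial j * N ^ j ≤ N.descFactorial j * K ^ j := by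
  induction j with
  | zero => simp
  | succ j ih =>
    rw [Nat.descFactorial_succ, Nat.descFactorial_succ, pow_succ, pow_succ]
    have h1 : (K - j) * N ≤ (N - j) * K := by
      rw [Nat.sub_mul, Nat.sub_mul]
      have : j * K ≤ j * N := Nat.mul_le_mul_left _ h
      rw [Nat.mul_comm K N]
      omega
    calc (K - j) * K.descFactorial j * (N ^ j * N)
        = (K.descFactorial j * N ^ j) * ((K - j) * N) := by ring
      _ ≤ (N.descFactorial j * K ^ j) * ((N - j) * K) := Nat.mul_le_mul ih h1
      _ = _ := by ring

lemma aux_choose (K N j : ℕ) (h : K ≤ N) :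
    (K.choose j : ℝ) ≤ N.choose j * ((K : ℝ) / N) ^ j := by
  rcases Nat.eq_zero_or_pos N with h0 | h0
  · have : K = 0 := by omega
    subst this; subst h0
    cases j <;> simp
  have h1 := aux_desc K N j h
  rw [Nat.descFactorial_eq_factorial_mul_choose, Nat.descFactorial_eq_factorial_mul_choose,
    mul_assoc, mul_assoc] at h1
  have h2 := Nat.le_of_mul_le_mul_left h1 (Nat.factorial_pos j)
  have h3 : (K.choose j : ℝ) * N ^ j ≤ N.choose j * K ^ j := by exact_mod_cast h2
  rw [div_pow, mul_div_assoc', le_div_iff₀ (by positivity)]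
  exact h3

open Finset in
lemma aux_count {α : Type*} [DecidableEq α] (U T : Finset α) (n : ℕ) (hT : T ⊆ U) :
    ((U.powersetCard n).filter (fun S => T ⊆ S)).card ≤
      if T.card ≤ n then (U.card - T.card).choose (n - T.card) else 0 := by
  split_ifs with h
  · rw [← card_sdiff_of_subset hT, ← card_powersetCard]
    apply card_le_card_of_injOn (fun S => S \ T)
    · intro S hS
      simp only [coe_filter, mem_powersetCard, Set.mem_ofPred_eq] at hS
      simp only [mem_coe, mem_powersetCard]
      exact ⟨sdiff_subset_sdiff hS.1.1 le_rfl, by rw [card_sdiff_of_subset hS.2, hS.1.2]⟩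
    · intro S hS S' hS' he
      simp only [coe_filter, mem_powersetCard, Set.mem_ofPred_eq] at hS hS'
      simp only at he
      rw [← sdiff_union_of_subset hS.2, he, sdiff_union_of_subset hS'.2]
  · simp only [nonpos_iff_eq_zero, card_eq_zero, filter_eq_empty_iff, mem_powersetCard]
    intro S hS hTS
    exact h (hS.2 ▸ card_le_card hTS)

open Finset in
lemma aux_mgf {α : Type*} [DecidableEq α] (U M : Finset α) (n : ℕ) (hMU : M ⊆ U)
    (hn : n ≤ U.card) (y : ℝ) (hy : 0 ≤ y) :
    ∑ S ∈ U.powersetCard n, (y + 1) ^ (S ∩ M).card ≤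
      (U.card.choose n : ℝ) * ((M.card : ℝ) / U.card * y + 1) ^ n := by
  set p : ℝ := (M.card : ℝ) / U.card with hp
  have hp0 : 0 ≤ p := by positivity
  let c : ℕ → ℕ := fun j => if j ≤ n then (U.card - j).choose (n - j) else 0
  have e1 : ∀ S : Finset α, (y + 1) ^ (S ∩ M).card
      = ∑ T ∈ M.powerset, if T ⊆ S then y ^ T.card else 0 := by
    intro S
    rw [← sum_pow_mul_eq_add_pow, ← sum_filter]
    apply sum_congr
    · ext T
      simp only [mem_powerset, mem_filter, subset_inter_iff]
      tauto
    · intros; simp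
  have key : ∀ j, (M.card.choose j : ℝ) * c j ≤ U.card.choose n * (n.choose j * p ^ j) := by
    intro j
    by_cases hj : j ≤ n
    · simp only [c, if_pos hj]
      have h1 := Nat.choose_mul (n := U.card) hj
      have h2 : (U.card.choose n : ℝ) * n.choose j
        = U.card.choose j * (U.card - j).choose (n - j) := by exact_mod_cast h1
      have h3 := aux_choose M.card U.card j (card_le_card hMU)
      rw [← mul_assoc, h2]
      calc _ ≤ (U.card.choose j * p ^ j) * ((U.card - j).choose (n - j) : ℝ) := by gcongr
        _ = _ := by ring
    · simp only [c, if_neg hj]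
      simp only [Nat.cast_zero, mul_zero]
      positivity
  calc ∑ S ∈ U.powersetCard n, (y + 1) ^ (S ∩ M).card
      = ∑ T ∈ M.powerset, ∑ S ∈ U.powersetCard n, if T ⊆ S then y ^ T.card else 0 := by
        rw [sum_comm]; exact sum_congr rfl fun S _ => e1 S
    _ ≤ ∑ T ∈ M.powerset, (c T.card : ℝ) * y ^ T.card := by
        apply sum_le_sum
        intro T hT
        rw [← sum_filter, sum_const, nsmul_eq_mul]
        have := aux_count U T n ((mem_powerset.1 hT).trans hMU)
        gcongr
    _ = ∑ j ∈ range (M.card + 1), (M.card.choose j : ℝ) * (c j * y ^ j) := by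
        rw [sum_powerset_apply_card (fun j => (c j : ℝ) * y ^ j)]
        simp
    _ ≤ ∑ j ∈ range (M.card + 1), (U.card.choose n : ℝ) * (n.choose j * (p * y) ^ j) := by
        apply sum_le_sum
        intro j _
        rw [mul_pow]
        calc _ = (M.card.choose j : ℝ) * c j * y ^ j := by ring
          _ ≤ U.card.choose n * (n.choose j * p ^ j) * y ^ j := 
              mul_le_mul_of_nonneg_right (key j) (by positivity)
          _ = _ := by ring
    _ ≤ ∑ j ∈ range (M.card + n + 1), (U.card.choose n : ℝ) * (n.choose j * (p * y) ^ j) := by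
        apply sum_le_sum_of_subset_of_nonneg
        · intro j; simp only [mem_range]; omega
        · intros; positivity
    _ = ∑ j ∈ range (n + 1), (U.card.choose n : ℝ) * (n.choose j * (p * y) ^ j) := by
        symm
        apply sum_subset
        · intro j; simp only [mem_range]; omega
        · intro j _ hj
          simp only [mem_range] at hj
          rw [Nat.choose_eq_zero_of_lt (show n < j by omega)]; simp
    _ = _ := by
        rw [add_pow, mul_sum]
        apply sum_congr rfl
        intros; rw [one_pow]; ring

open MeasureTheory ProbabilityTheory in
lemma aux_hoeffding (p t : ℝ) (h0 : 0 ≤ p) (h1 : p ≤ 1) :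
    p * (Real.exp t - 1) + 1 ≤ Real.exp (p * t + t ^ 2 / 8) := by
  let μ : Measure ℝ := ENNReal.ofReal p • Measure.dirac 1 + ENNReal.ofReal (1 - p) • Measure.dirac 0
  have hμ : IsProbabilityMeasure μ := by
    constructor
    simp only [μ, Measure.add_apply, Measure.smul_apply, smul_eq_mul, measure_univ, mul_one]
    rw [← ENNReal.ofReal_add h0 (by linarith)]
    simp
  have hI : ∀ f : ℝ → ℝ, ∫ x, f x ∂μ = p * f 1 + (1 - p) * f 0 := by
    intro f
    have hi : ∀ a b : ℝ, Integrable f (ENNReal.ofReal a • Measure.dirac b) := fun a b =>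
      (integrable_dirac (by simp)).smul_measure (by simp)
    rw [integral_add_measure (hi _ _) (hi _ _), integral_smul_measure, integral_smul_measure,
      integral_dirac, integral_dirac, ENNReal.toReal_ofReal h0,
      ENNReal.toReal_ofReal (by linarith)]
    simp
  have hs := hasSubgaussianMGF_of_mem_Icc (μ := μ) (X := fun x => x) (a := 0) (b := 1)
    aemeasurable_id (by
      simp only [μ]
      rw [ae_add_measure_iff]
      constructor <;> apply Measure.ae_smul_measure <;> 
        simp [ae_dirac_eq])
  have h := hs.mgf_le t
  rw [mgf, hI, hI] at h
  simp at h
  have e : p * Real.exp (t * (1 - p)) + (1 - p) * Real.exp (-(t * p)) =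
    (p * (Real.exp t - 1) + 1) * Real.exp (-(t * p)) := by
    rw [show t * (1 - p) = t + -(t * p) by ring, Real.exp_add]; ring
  rw [e] at h
  calc p * (Real.exp t - 1) + 1
      = ((p * (Real.exp t - 1) + 1) * Real.exp (-(t * p))) * Real.exp (t * p) := by
        rw [mul_assoc, ← Real.exp_add]; simp
    _ ≤ Real.exp (t ^ 2 / 8) * Real.exp (t * p) := by
        gcongr
        refine h.trans (le_of_eq ?_)
        congr 1
        norm_num
        ring
    _ = _ := by rw [← Real.exp_add]; congr 1; ring

/-- Hypergeometric upper tail bound (counting form): the number of `n`-element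
subsets `S` of a set `U` of size `N` with `|S ∩ M| ≥ (p + w)·n` is at most
`exp(-2 w² n) · C(N, n)`, where `M ⊆ U` has size `K` and `p = K/N`. -/
theorem hypergeometric_upper_tail {α : Type*} [DecidableEq α]
    (U M : Finset α) (N K n : ℕ)
    (hU : U.card = N) (hMU : M ⊆ U) (hM : M.card = K) (hn : n ≤ N)
    (p : ℝ) (hp : p = (K : ℝ) / N) (w : ℝ) (hw : 0 ≤ w) :
    (Nat.card {S : Finset α // S ⊆ U ∧ S.card = n ∧
        (p + w) * n ≤ ((S ∩ M).card : ℝ)} : ℝ)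
      ≤ Real.exp (-2 * w ^ 2 * n) * (N.choose n) := by
  classical
  subst hU hM
  have hp0 : 0 ≤ p := by rw [hp]; positivity
  have hp1 : p ≤ 1 := by
    rw [hp]
    apply div_le_one_of_le₀ _ (by positivity)
    exact_mod_cast Finset.card_le_card hMU
  let A := (U.powersetCard n).filter (fun S => (p + w) * n ≤ ((S ∩ M).card : ℝ))
  have hA : Nat.card {S : Finset α // S ⊆ U ∧ S.card = n ∧
        (p + w) * n ≤ ((S ∩ M).card : ℝ)} = A.card := by
    rw [← Nat.card_eq_finsetCard A]
    apply Nat.card_congr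
    apply Equiv.subtypeEquivRight
    intro S
    simp [A, and_assoc]
  rw [hA]
  have hexp : 0 ≤ Real.exp (4 * w) - 1 := by
    have := Real.add_one_le_exp (4 * w); linarith
  have h1 := aux_mgf U M n hMU hn (Real.exp (4 * w) - 1) hexp
  rw [← hp] at h1
  have h2 : (A.card : ℝ) * Real.exp (4 * w * ((p + w) * n)) ≤
      ∑ S ∈ U.powersetCard n, (Real.exp (4 * w) - 1 + 1) ^ (S ∩ M).card := by
    rw [← nsmul_eq_mul, ← Finset.sum_const]
    refine le_trans ?_ (Finset.sum_le_sum_of_subset_of_nonneg (show A ⊆ U.powersetCard n from Finset.filter_subset _ _)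
      (fun _ _ _ => by positivity))
    apply Finset.sum_le_sum
    intro S hS
    rw [sub_add_cancel, ← Real.exp_nat_mul, mul_comm ((S ∩ M).card : ℝ)]
    apply Real.exp_le_exp.2
    exact mul_le_mul_of_nonneg_left (Finset.mem_filter.1 hS).2 (by positivity)
  have h3 : (p * (Real.exp (4 * w) - 1) + 1) ^ n ≤ Real.exp (n * (p * (4 * w) + (4 * w) ^ 2 / 8)) := by
    rw [Real.exp_nat_mul]
    exact pow_le_pow_left₀ (by positivity) (aux_hoeffding p (4 * w) hp0 hp1) n
  have h4 : (A.card : ℝ) * Real.exp (4 * w * ((p + w) * n)) ≤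
      (U.card.choose n : ℝ) * Real.exp (n * (p * (4 * w) + (4 * w) ^ 2 / 8)) :=
    h2.trans (h1.trans (by gcongr))
  rw [← le_div_iff₀ (Real.exp_pos _), mul_div_assoc, ← Real.exp_sub] at h4
  refine h4.trans (le_of_eq ?_)
  rw [mul_comm]
  congr 2
  ring
end

section
/- Let U be a finite set of size N, let M ⊆ U be a subset of size K, and write p = K/N. If S is a uniformly random subset of U of size n, then for every real w ≥ 0, the probability that |S ∩ M| ≤ (p − w)·n is at most exp(-2·w²·n). Equivalently, the number of n-element subsets S of U with |S ∩ M| ≤ (p − w)·n is at most exp(-2·w²·n) · C(N, n). -/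
open MeasureTheory ProbabilityTheory in
lemma bern_mgf (q l : ℝ) (h0 : 0 ≤ q) (h1 : q ≤ 1) :
    1 + q * (Real.exp l - 1) ≤ Real.exp (q * l + l ^ 2 / 8) := by
  let μ : Measure ℝ := ENNReal.ofReal q • Measure.dirac 1 + ENNReal.ofReal (1 - q) • Measure.dirac 0
  have hprob : IsProbabilityMeasure μ := by
    constructor
    simp only [μ, Measure.add_apply, Measure.smul_apply, measure_univ, smul_eq_mul, mul_one]
    rw [← ENNReal.ofReal_add h0 (by linarith)]
    simp
  have hint : ∀ f : ℝ → ℝ, ∫ x, f x ∂μ = q * f 1 + (1 - q) * f 0 := by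
    intro f
    have i1 : Integrable f (ENNReal.ofReal q • Measure.dirac (1:ℝ)) :=
      (integrable_dirac (by simp)).smul_measure (by simp)
    have i2 : Integrable f (ENNReal.ofReal (1 - q) • Measure.dirac (0:ℝ)) :=
      (integrable_dirac (by simp)).smul_measure (by simp)
    rw [integral_add_measure i1 i2, integral_smul_measure, integral_smul_measure,
      integral_dirac, integral_dirac, ENNReal.toReal_ofReal h0,
      ENNReal.toReal_ofReal (by linarith)]
    simp
  have hae : ∀ᵐ x ∂μ, id x ∈ Set.Icc (0:ℝ) 1 := by
    simp only [μ, ae_add_measure_iff]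
    constructor
    · apply Measure.ae_smul_measure
      have hs : MeasurableSet {x : ℝ | id x ∈ Set.Icc (0:ℝ) 1} := measurableSet_Icc
      rw [ae_dirac_iff hs]; simp
    · apply Measure.ae_smul_measure
      have hs : MeasurableSet {x : ℝ | id x ∈ Set.Icc (0:ℝ) 1} := measurableSet_Icc
      rw [ae_dirac_iff hs]; simp
  have h := (hasSubgaussianMGF_of_mem_Icc (μ := μ) (X := id) aemeasurable_id hae).mgf_le l
  simp only [mgf, hint, id] at h
  norm_num at h
  have e1 : Real.exp (l * (1 - q)) = Real.exp l * Real.exp (-(q * l)) := by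
    rw [← Real.exp_add]; congr 1; ring
  have e2 : Real.exp (-(l * q)) = Real.exp (-(q * l)) := by
    congr 1; ring
  rw [e1, e2] at h
  have e3 : Real.exp (q * l + l ^ 2 / 8) = Real.exp (q * l) * Real.exp (1 / 4 * l ^ 2 / 2) := by
    rw [← Real.exp_add]; congr 1; ring
  have e4 : Real.exp (q * l) * Real.exp (-(q * l)) = 1 := by
    rw [← Real.exp_add]; simp
  rw [e3]
  calc 1 + q * (Real.exp l - 1)
      = (Real.exp (q * l) * Real.exp (-(q * l))) * (1 + q * (Real.exp l - 1)) := by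
        rw [e4]; ring
    _ = Real.exp (q * l) * (q * (Real.exp l * Real.exp (-(q * l))) + (1 - q) * Real.exp (-(q * l))) := by ring
    _ ≤ _ := by
        apply mul_le_mul_of_nonneg_left _ (Real.exp_pos _).le
        convert h using 2

lemma desc_ineq (L N j : ℕ) (h : L ≤ N) :
    L.descFactorial j * N ^ j ≤ L ^ j * N.descFactorial j := by
  induction j with
  | zero => simp
  | succ j ih =>
    rw [Nat.descFactorial_succ, Nat.descFactorial_succ, pow_succ, pow_succ]
    have : (L - j) * N ≤ L * (N - j) := by
      rw [Nat.sub_mul, Nat.mul_sub]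
      have : L * j ≤ j * N := by rw [mul_comm]; exact Nat.mul_le_mul_left _ h
      omega
    calc _ = ((L - j) * N) * (L.descFactorial j * N ^ j) := by ring
      _ ≤ (L * (N - j)) * (L ^ j * N.descFactorial j) := Nat.mul_le_mul this ih
      _ = _ := by ring

lemma choose_ineq (L N j : ℕ) (h : L ≤ N) :
    L.choose j * N ^ j ≤ L ^ j * N.choose j := by
  have := desc_ineq L N j h
  rw [Nat.descFactorial_eq_factorial_mul_choose, Nat.descFactorial_eq_factorial_mul_choose] at this
  apply Nat.le_of_mul_le_mul_left _ (Nat.factorial_pos j)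
  calc _ = _ := by ring
    _ ≤ _ := this
    _ = _ := by ring

lemma count_super {α : Type*} [DecidableEq α] (U T : Finset α) (n : ℕ) (hT : T ⊆ U) :
    ((U.powersetCard n).filter (T ⊆ ·)).card ≤
      if T.card ≤ n then (U.card - T.card).choose (n - T.card) else 0 := by
  split_ifs with h
  · rw [← Finset.card_sdiff_of_subset hT, ← Finset.card_powersetCard]
    apply Finset.card_le_card_of_injOn (· \ T)
    · intro S hS
      simp only [Finset.coe_filter, Finset.mem_powersetCard, Set.mem_ofPred_eq] at hS
      simp only [Finset.mem_coe, Finset.mem_powersetCard]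
      refine ⟨Finset.sdiff_subset_sdiff hS.1.1 le_rfl, ?_⟩
      rw [Finset.card_sdiff_of_subset hS.2, hS.1.2]
    · intro S hS S' hS' he
      simp only [Finset.coe_filter, Set.mem_ofPred_eq] at hS hS'
      simp only at he
      rw [← Finset.sdiff_union_of_subset hS.2, he, Finset.sdiff_union_of_subset hS'.2]
  · rw [Nat.le_zero, Finset.card_eq_zero, Finset.filter_eq_empty_iff]
    intro S hS hTS
    have := Finset.card_le_card hTS
    rw [(Finset.mem_powersetCard.1 hS).2] at this
    exact h this

lemma mgf_bound {α : Type*} [DecidableEq α] (U A : Finset α) (n : ℕ) (hA : A ⊆ U)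
    (hN : 0 < U.card) (z : ℝ) (hz : 0 ≤ z) :
    ∑ S ∈ U.powersetCard n, (1 + z) ^ (S ∩ A).card ≤
      (U.card.choose n) * (1 + (A.card / U.card : ℝ) * z) ^ n := by
  have hLN := Finset.card_le_card hA
  have hNR : (0:ℝ) < U.card := by exact_mod_cast hN
  set q : ℝ := (A.card / U.card : ℝ) with hq
  have hq0 : 0 ≤ q := by positivity
  have s1 : ∀ S : Finset α, (1 + z) ^ (S ∩ A).card =
      ∑ T ∈ A.powerset, if T ⊆ S then z ^ T.card else 0 := by
    intro S
    rw [← Finset.sum_filter]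
    have : A.powerset.filter (· ⊆ S) = (S ∩ A).powerset := by
      ext T; simp only [Finset.mem_filter, Finset.mem_powerset, Finset.subset_inter_iff, and_comm]
    rw [this, Finset.sum_powerset_apply_card (fun j => z ^ j), add_comm, add_pow]
    apply Finset.sum_congr rfl
    intro j _
    simp [mul_comm]
  have s2 : ∑ S ∈ U.powersetCard n, (1 + z) ^ (S ∩ A).card ≤
      ∑ T ∈ A.powerset, ((if T.card ≤ n then (U.card - T.card).choose (n - T.card) else 0 : ℕ) : ℝ)
        * z ^ T.card := by
    simp_rw [s1]
    rw [Finset.sum_comm]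
    apply Finset.sum_le_sum
    intro T hT
    rw [← Finset.sum_filter, Finset.sum_const, nsmul_eq_mul]
    apply mul_le_mul_of_nonneg_right _ (by positivity)
    exact_mod_cast count_super U T n ((Finset.mem_powerset.1 hT).trans hA)
  refine s2.trans ?_
  rw [Finset.sum_powerset_apply_card
    (fun j => ((if j ≤ n then (U.card - j).choose (n - j) else 0 : ℕ) : ℝ) * z ^ j)]
  have s3 : ∀ j, A.card.choose j •
      (((if j ≤ n then (U.card - j).choose (n - j) else 0 : ℕ) : ℝ) * z ^ j) ≤
      (U.card.choose n) * ((q * z) ^ j * (n.choose j)) := by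
    intro j
    split_ifs with hj
    · have c1 : (U.card.choose n : ℝ) * n.choose j = U.card.choose j * (U.card - j).choose (n - j) := by
        exact_mod_cast Nat.choose_mul hj
      have c2 : (A.card.choose j : ℝ) ≤ q ^ j * U.card.choose j := by
        rw [hq, div_pow, div_mul_eq_mul_div, le_div_iff₀ (by positivity)]
        exact_mod_cast choose_ineq _ _ j hLN
      rw [nsmul_eq_mul, mul_pow]
      calc _ = (A.card.choose j : ℝ) * (((U.card - j).choose (n - j) : ℕ) * z ^ j) := rfl
        _ ≤ (q ^ j * U.card.choose j) * (((U.card - j).choose (n - j) : ℕ) * z ^ j) := by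
          gcongr
        _ = (U.card.choose j * (U.card - j).choose (n - j)) * (q ^ j * z ^ j) := by ring
        _ = _ := by rw [← c1]; ring
    · simp only [Nat.cast_zero, zero_mul, smul_zero]; positivity
  refine (Finset.sum_le_sum fun j _ => s3 j).trans ?_
  rw [← Finset.mul_sum]
  apply mul_le_mul_of_nonneg_left _ (by positivity)
  rw [add_comm 1, add_pow]
  simp only [one_pow, mul_one]
  have h2 : ∑ j ∈ Finset.range (n + 1), (q * z) ^ j * (n.choose j : ℝ) =
      ∑ j ∈ Finset.range (max n A.card + 1), (q * z) ^ j * (n.choose j : ℝ) := by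
    apply Finset.sum_subset
    · intro j; simp only [Finset.mem_range]; omega
    · intro j _ h
      rw [Nat.choose_eq_zero_of_lt (by simpa using h)]; simp
  rw [h2]
  apply Finset.sum_le_sum_of_subset_of_nonneg
  · intro j; simp only [Finset.mem_range]; omega
  · intros; positivity

/-- Hypergeometric lower tail bound (counting form): the number of `n`-element
subsets `S` of a set `U` of size `N` with `|S ∩ M| ≤ (p − w)·n` is at most
`exp(-2 w² n) · C(N, n)`, where `M ⊆ U` has size `K` and `p = K/N`. -/
theorem hypergeometric_lower_tail {α : Type*} [DecidableEq α]
    (U M : Finset α) (N K n : ℕ)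
    (hU : U.card = N) (hMU : M ⊆ U) (hM : M.card = K) (hn : n ≤ N)
    (p : ℝ) (hp : p = (K : ℝ) / N) (w : ℝ) (hw : 0 ≤ w) :
    (Nat.card {S : Finset α // S ⊆ U ∧ S.card = n ∧
        ((S ∩ M).card : ℝ) ≤ (p - w) * n} : ℝ)
      ≤ Real.exp (-2 * w ^ 2 * n) * (N.choose n) := by
  classical
  have hcard : Nat.card {S : Finset α // S ⊆ U ∧ S.card = n ∧
        ((S ∩ M).card : ℝ) ≤ (p - w) * n} =
      ((U.powersetCard n).filter (fun S => ((S ∩ M).card : ℝ) ≤ (p - w) * n)).card := by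
    apply Nat.subtype_card
    intro S
    simp [Finset.mem_powersetCard, and_assoc]
  rw [hcard]
  set F := (U.powersetCard n).filter (fun S => ((S ∩ M).card : ℝ) ≤ (p - w) * n) with hF
  rcases Nat.eq_zero_or_pos n with h0 | hpos
  · subst h0
    have : F.card ≤ N.choose 0 := by
      rw [← hU, ← Finset.card_powersetCard]; exact Finset.card_filter_le _ _
    simp only [Nat.cast_zero, mul_zero, Real.exp_zero, one_mul]
    exact_mod_cast this
  have hN : 0 < U.card := by omega
  have hNR : (0:ℝ) < N := by rw [← hU]; exact_mod_cast hN
  have hKN : K ≤ N := by rw [← hM, ← hU]; exact Finset.card_le_card hMU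
  have hL : ((U \ M).card : ℝ) / U.card = 1 - p := by
    rw [Finset.card_sdiff_of_subset hMU, hU, hM, Nat.cast_sub hKN, hp]
    field_simp
  have hp0 : 0 ≤ p := by rw [hp]; positivity
  have hp1 : p ≤ 1 := by rw [hp, div_le_one hNR]; exact_mod_cast hKN
  have hz : 0 ≤ Real.exp (4 * w) - 1 := by
    have := Real.add_one_le_exp (4 * w); linarith
  have hm := mgf_bound U (U \ M) n Finset.sdiff_subset hN _ hz
  rw [hL, hU] at hm
  have hb := bern_mgf (1 - p) (4 * w) (by linarith) (by linarith)
  have hb' : (1 + (1 - p) * (Real.exp (4 * w) - 1)) ^ n ≤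
      Real.exp (n * ((1 - p) * (4 * w) + (4 * w) ^ 2 / 8)) := by
    rw [Real.exp_nat_mul]
    exact pow_le_pow_left₀ (by have := mul_nonneg (sub_nonneg.2 hp1) hz; linarith) hb n
  have hlow : (F.card : ℝ) * Real.exp (4 * w * ((1 - p + w) * n)) ≤
      ∑ S ∈ U.powersetCard n, (1 + (Real.exp (4 * w) - 1)) ^ (S ∩ (U \ M)).card := by
    rw [← nsmul_eq_mul, ← Finset.sum_const]
    refine le_trans (Finset.sum_le_sum (g := fun S =>
      (1 + (Real.exp (4 * w) - 1)) ^ (S ∩ (U \ M)).card) ?_)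
      (Finset.sum_le_sum_of_subset_of_nonneg (Finset.filter_subset _ _) ?_)
    · intro S hS
      rw [hF, Finset.mem_filter, Finset.mem_powersetCard] at hS
      obtain ⟨⟨hSU, hSn⟩, hS2⟩ := hS
      have e : S ∩ (U \ M) = S \ M := by
        ext x; simp only [Finset.mem_inter, Finset.mem_sdiff]
        exact ⟨fun h => ⟨h.1, h.2.2⟩, fun h => ⟨h.1, hSU h.1, h.2⟩⟩
      have e2 : ((S \ M).card : ℝ) + (S ∩ M).card = n := by
        rw [← hSn]; exact_mod_cast Finset.card_sdiff_add_card_inter S M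
      simp only [e, add_sub_cancel]
      rw [← Real.exp_nat_mul, Real.exp_le_exp, mul_comm]
      apply mul_le_mul_of_nonneg_right _ (by linarith)
      linarith
    · intros; positivity
  have hfin := hlow.trans (hm.trans (mul_le_mul_of_nonneg_left hb' (by positivity)))
  have key : Real.exp (n * ((1 - p) * (4 * w) + (4 * w) ^ 2 / 8)) =
      Real.exp (-2 * w ^ 2 * n) * Real.exp (4 * w * ((1 - p + w) * n)) := by
    rw [← Real.exp_add]; congr 1; ring
  rw [key] at hfin
  apply le_of_mul_le_mul_right _ (Real.exp_pos (4 * w * ((1 - p + w) * n)))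
  calc _ ≤ _ := hfin
    _ = _ := by ring
end

section
/- (Shamir security, Lemma 1.) Let N = s·k with s, k ≥ 1, let 0 ≤ γ < ξ ≤ 1 and σ ≥ 0 be reals, and let A ⊆ Fin N be any subset with |A| ≤ γ·N. Partition Fin N uniformly at random into s clusters of size k (via a uniformly random permutation of Fin N, taking consecutive index blocks of length k as clusters). If 2·(ξ − γ)²·k + ln k − ln N − σ·ln 2 ≥ 0, then with probability at least 1 − 2^{−σ}, every cluster c satisfies |c ∩ A| < ξ·k; i.e., the probability that some cluster contains at least t = ξ·k adversarial users is at most 2^{−σ}. -/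
/-- The `j`-th block of the random clustering induced by a permutation `π` of
`Fin N`: the image under `π` of the indices `i` with `j·k ≤ i < (j+1)·k`. -/
def clusterBlock (N k j : ℕ) (π : Equiv.Perm (Fin N)) : Finset (Fin N) :=
  (Finset.univ.filter fun i : Fin N => j * k ≤ (i : ℕ) ∧ (i : ℕ) < (j + 1) * k).image π

open Finset in
lemma perm_count_step {N : ℕ} (A T : Finset (Fin N)) (i : Fin N) (hi : i ∉ T) :
    N * #{π : Equiv.Perm (Fin N) | ∀ j ∈ insert i T, π j ∈ A}
      ≤ #A * #{π : Equiv.Perm (Fin N) | ∀ j ∈ T, π j ∈ A} := by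
  have h1 : ∑ j : Fin N, #{π : Equiv.Perm (Fin N) | ∀ l ∈ insert j T, π l ∈ A}
      = #A * #{π : Equiv.Perm (Fin N) | ∀ j ∈ T, π j ∈ A} := by
    simp only [Finset.card_filter]
    rw [Finset.sum_comm, Finset.mul_sum]
    refine Finset.sum_congr rfl fun π _ => ?_
    by_cases h : ∀ j ∈ T, π j ∈ A
    · rw [if_pos h, mul_one]
      simp only [Finset.forall_mem_insert]
      rw [← Finset.card_filter]
      refine Finset.card_bij (fun a _ => π a) ?_ ?_ ?_
      · intro a ha
        simp at ha
        exact ha.1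
      · intro a _ b _ hab
        exact π.injective hab
      · intro b hb
        exact ⟨π.symm b, by simpa using ⟨hb, h⟩, by simp⟩
    · simp only [Finset.forall_mem_insert, h, and_false, if_false, mul_zero]
      simp
  rw [← h1]
  have h2 : ∀ j ∈ (Finset.univ : Finset (Fin N)),
      #{π : Equiv.Perm (Fin N) | ∀ l ∈ insert i T, π l ∈ A}
      ≤ #{π : Equiv.Perm (Fin N) | ∀ l ∈ insert j T, π l ∈ A} := by
    intro j _
    by_cases hj : j ∈ T
    · refine Finset.card_le_card fun π hπ => ?_
      simp only [Finset.mem_filter, Finset.mem_univ, true_and] at hπ ⊢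
      intro l hl
      rw [Finset.insert_eq_of_mem hj] at hl
      exact hπ l (Finset.mem_insert_of_mem hl)
    · refine Finset.card_le_card_of_injOn (fun π => π * Equiv.swap i j) ?_ ?_
      · intro π hπ
        simp only [Finset.coe_filter, Finset.mem_univ, true_and, Set.mem_ofPred_eq,
          Finset.forall_mem_insert] at hπ ⊢
        refine ⟨by simpa using hπ.1, fun l hl => ?_⟩
        have hli : l ≠ i := fun h => hi (h ▸ hl)
        have hlj : l ≠ j := fun h => hj (h ▸ hl)
        simpa [Equiv.swap_apply_of_ne_of_ne hli hlj] using hπ.2 l hl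
      · intro a _ b _ hab
        exact mul_right_cancel hab
  have := Finset.card_nsmul_le_sum _ _ _ h2
  simpa using this

open Finset in
lemma perm_count {N : ℕ} (A T : Finset (Fin N)) :
    N ^ #T * #{π : Equiv.Perm (Fin N) | ∀ j ∈ T, π j ∈ A} ≤ #A ^ #T * N.factorial := by
  induction T using Finset.induction_on with
  | empty => simp [Fintype.card_perm]
  | insert i T hi ih =>
    rw [Finset.card_insert_of_notMem hi, pow_succ, mul_assoc]
    calc _ ≤ N ^ #T * (#A * #{π : Equiv.Perm (Fin N) | ∀ j ∈ T, π j ∈ A}) :=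
          Nat.mul_le_mul_left _ (perm_count_step A T i hi)
      _ = #A * (N ^ #T * #{π : Equiv.Perm (Fin N) | ∀ j ∈ T, π j ∈ A}) := by ring
      _ ≤ #A * (#A ^ #T * N.factorial) := Nat.mul_le_mul_left _ ih
      _ = _ := by ring

open Finset in
lemma mgf_bound_s4 {N : ℕ} (hN : 0 < N) (A B : Finset (Fin N)) (u γ : ℝ) (hu : 0 ≤ u)
    (hA : (#A : ℝ) ≤ γ * N) :
    ∑ π : Equiv.Perm (Fin N), (1 + u) ^ #{i ∈ B | π i ∈ A}
      ≤ (1 + γ * u) ^ #B * N.factorial := by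
  have hN' : (0 : ℝ) < N := by exact_mod_cast hN
  have e1 : ∀ π : Equiv.Perm (Fin N), (1 + u) ^ #{i ∈ B | π i ∈ A}
      = ∑ T ∈ B.powerset, u ^ #T * (if ∀ j ∈ T, π j ∈ A then 1 else 0) := by
    intro π
    have : (1 + u) ^ #{i ∈ B | π i ∈ A} = ∏ i ∈ B, (1 + if π i ∈ A then u else 0) := by
      rw [← Finset.prod_const, Finset.prod_filter]
      refine Finset.prod_congr rfl fun i _ => ?_
      split_ifs <;> simp
    rw [this, Finset.prod_one_add]
    refine Finset.sum_congr rfl fun T _ => ?_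
    split_ifs with h
    · rw [mul_one, ← Finset.prod_const]
      exact Finset.prod_congr rfl fun i hi => by simp [h i hi]
    · push Not at h
      obtain ⟨j, hj, hj2⟩ := h
      rw [mul_zero]
      exact Finset.prod_eq_zero hj (by simp [hj2])
  simp only [e1]
  rw [Finset.sum_comm]
  have e2 : (1 + γ * u) ^ #B = ∑ T ∈ B.powerset, (γ * u) ^ #T := by
    rw [← Finset.prod_const, Finset.prod_one_add]
    simp
  rw [e2, Finset.sum_mul]
  refine Finset.sum_le_sum fun T _ => ?_
  rw [← Finset.mul_sum, ← Nat.cast_one, ← Nat.cast_zero]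
  have h := perm_count A T
  have h' : (N : ℝ) ^ #T * (#{π : Equiv.Perm (Fin N) | ∀ j ∈ T, π j ∈ A} : ℝ)
      ≤ (#A : ℝ) ^ #T * N.factorial := by exact_mod_cast h
  have h3 : (#A : ℝ) ^ #T ≤ (γ * N) ^ #T := by gcongr
  have h4 : (#{π : Equiv.Perm (Fin N) | ∀ j ∈ T, π j ∈ A} : ℝ) ≤ γ ^ #T * N.factorial := by
    refine le_of_mul_le_mul_left (h'.trans ?_) (pow_pos hN' #T)
    calc _ ≤ (γ * N) ^ #T * N.factorial := by gcongr
      _ = _ := by rw [mul_pow]; ring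
  have h5 : ∑ π : Equiv.Perm (Fin N), (if ∀ j ∈ T, π j ∈ A then ((1 : ℕ) : ℝ) else ((0 : ℕ) : ℝ))
      = (#{π : Equiv.Perm (Fin N) | ∀ j ∈ T, π j ∈ A} : ℝ) := by
    simp
  rw [h5, mul_pow]
  calc _ ≤ u ^ #T * (γ ^ #T * N.factorial) := by gcongr
    _ = _ := by ring

open MeasureTheory ProbabilityTheory in
lemma bernoulli_hoeffding (p l : ℝ) (hp : 0 ≤ p) (hp1 : p ≤ 1) :
    1 + p * (Real.exp l - 1) ≤ Real.exp (l * p + l ^ 2 / 8) := by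
  let μ : Measure ℝ := ENNReal.ofReal p • Measure.dirac 1 + ENNReal.ofReal (1 - p) • Measure.dirac 0
  have hμ : IsProbabilityMeasure μ := ⟨by
    simp only [μ, Measure.add_apply, Measure.smul_apply, measure_univ, smul_eq_mul, mul_one]
    rw [← ENNReal.ofReal_add hp (by linarith)]
    simp⟩
  have hint : ∀ f : ℝ → ℝ, ∫ x, f x ∂μ = p * f 1 + (1 - p) * f 0 := by
    intro f
    rw [integral_add_measure, integral_smul_measure, integral_smul_measure, integral_dirac,
      integral_dirac, ENNReal.toReal_ofReal hp, ENNReal.toReal_ofReal (by linarith)]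
    · simp
    · exact (integrable_dirac (by simp)).smul_measure (by simp)
    · exact (integrable_dirac (by simp)).smul_measure (by simp)
  have hm : ∀ᵐ x ∂μ, (id x : ℝ) ∈ Set.Icc (0 : ℝ) 1 := by
    simp only [μ, ae_add_measure_iff]
    constructor
    · exact Measure.ae_smul_measure (by simp [ae_dirac_eq]) _
    · exact Measure.ae_smul_measure (by simp [ae_dirac_eq]) _
  have h := (hasSubgaussianMGF_of_mem_Icc (μ := μ) (X := id) aemeasurable_id hm).mgf_le l
  simp only [mgf, hint] at h
  norm_num at h
  have h6 := mul_le_mul_of_nonneg_left h (Real.exp_pos (l * p)).le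
  rw [← Real.exp_add, mul_add, mul_left_comm, ← Real.exp_add, mul_left_comm, ← Real.exp_add] at h6
  ring_nf at h6 ⊢
  simp at h6
  linarith

/-- Shamir security (Lemma 1): if `|A| ≤ γ·N`, `0 ≤ γ < ξ ≤ 1`, `σ ≥ 0`, and
`2(ξ−γ)²k + ln k − ln N − σ ln 2 ≥ 0`, then a uniformly random partition of
`Fin N` into `s` clusters of size `k` (via a uniformly random permutation)
satisfies, with probability at least `1 − 2^{−σ}`, that every cluster contains
strictly fewer than `ξ·k` adversarial users. -/
theorem shamir_security
    (s k N : ℕ) (hN : N = s * k) (hs : 1 ≤ s) (hk : 1 ≤ k)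
    (γ ξ σ : ℝ) (hγ : 0 ≤ γ) (hγξ : γ < ξ) (hξ : ξ ≤ 1) (hσ : 0 ≤ σ)
    (A : Finset (Fin N)) (hA : (A.card : ℝ) ≤ γ * N)
    (hcond : 2 * (ξ - γ) ^ 2 * k + Real.log k - Real.log N - σ * Real.log 2 ≥ 0) :
    (1 - (2 : ℝ) ^ (-σ)) * (N.factorial : ℝ)
      ≤ (Nat.card {π : Equiv.Perm (Fin N) //
          ∀ j < s, (((clusterBlock N k j π) ∩ A).card : ℝ) < ξ * k} : ℝ) := by
  classical
  have hNpos : 0 < N := by rw [hN]; positivity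
  set E : ℝ := Real.exp (-(2 * (ξ - γ) ^ 2 * k)) with hE
  set bad : ℕ → Finset (Equiv.Perm (Fin N)) := fun j =>
    Finset.univ.filter fun π => ξ * k ≤ (((clusterBlock N k j π) ∩ A).card : ℝ) with hbad
  have hb : ∀ j, ((bad j).card : ℝ) ≤ E * N.factorial := by
    intro j
    set B : Finset (Fin N) :=
      Finset.univ.filter fun i : Fin N => j * k ≤ (i : ℕ) ∧ (i : ℕ) < (j + 1) * k with hB
    have hBk : B.card ≤ k := by
      have : B.card ≤ (Finset.Ico (j * k) ((j + 1) * k)).card := by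
        refine Finset.card_le_card_of_injOn (fun i => (i : ℕ)) ?_ ?_
        · intro i hi
          simpa [hB] using hi
        · intro a _ b _ hab
          exact Fin.ext hab
      rwa [Nat.card_Ico, add_mul, one_mul, Nat.add_sub_cancel_left] at this
    have hX : ∀ π : Equiv.Perm (Fin N),
        ((clusterBlock N k j π) ∩ A).card = (B.filter fun i => π i ∈ A).card := by
      intro π
      rw [← Finset.card_image_of_injective (B.filter fun i => π i ∈ A) π.injective]
      congr 1
      ext x
      simp only [clusterBlock, ← hB, Finset.mem_inter, Finset.mem_image, Finset.mem_filter]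
      constructor
      · rintro ⟨⟨i, hi, rfl⟩, hx⟩
        exact ⟨i, ⟨hi, hx⟩, rfl⟩
      · rintro ⟨i, ⟨hi, hx⟩, rfl⟩
        exact ⟨⟨i, hi, rfl⟩, hx⟩
    set l : ℝ := 4 * (ξ - γ) with hl
    have hl0 : 0 ≤ l := by rw [hl]; linarith
    have hu : 0 ≤ Real.exp l - 1 := by linarith [Real.add_one_le_exp l]
    have h1 := mgf_bound_s4 hNpos A B (Real.exp l - 1) γ hu hA
    have h2 : ((bad j).card : ℝ) * Real.exp (l * (ξ * k)) ≤
        ∑ π : Equiv.Perm (Fin N), (1 + (Real.exp l - 1)) ^ (B.filter fun i => π i ∈ A).card := by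
      rw [← nsmul_eq_mul]
      refine (Finset.card_nsmul_le_sum (bad j) _ _ ?_).trans
        (Finset.sum_le_sum_of_subset_of_nonneg (Finset.subset_univ _) ?_)
      · intro π hπ
        simp only [hbad, Finset.mem_filter, Finset.mem_univ, true_and, hX] at hπ
        rw [add_sub_cancel, ← Real.exp_nat_mul, mul_comm _ l]
        exact Real.exp_le_exp.2 (mul_le_mul_of_nonneg_left hπ hl0)
      · intro π _ _
        positivity
    have h3 : (1 + γ * (Real.exp l - 1)) ^ B.card ≤ Real.exp (k * (l * γ + l ^ 2 / 8)) := by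
      rw [Real.exp_nat_mul]
      have h0 : 1 ≤ 1 + γ * (Real.exp l - 1) := by nlinarith [mul_nonneg hγ hu]
      exact (pow_le_pow_right₀ h0 hBk).trans
        (pow_le_pow_left₀ (by linarith) (bernoulli_hoeffding γ l hγ (by linarith)) k)
    have h4 : Real.exp (k * (l * γ + l ^ 2 / 8)) = E * Real.exp (l * (ξ * k)) := by
      rw [hE, ← Real.exp_add]
      congr 1
      rw [hl]
      ring
    refine le_of_mul_le_mul_right ?_ (Real.exp_pos (l * (ξ * k)))
    calc _ ≤ _ := h2
      _ ≤ _ := h1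
      _ ≤ Real.exp (k * (l * γ + l ^ 2 / 8)) * N.factorial := by gcongr
      _ = _ := by rw [h4]; ring
  have hsE : (s : ℝ) * E ≤ (2 : ℝ) ^ (-σ) := by
    have hs0 : (0 : ℝ) < s := by exact_mod_cast hs
    have hk0 : (0 : ℝ) < k := by exact_mod_cast hk
    have hlog : Real.log N = Real.log s + Real.log k := by
      rw [hN, Nat.cast_mul, Real.log_mul hs0.ne' hk0.ne']
    rw [Real.rpow_def_of_pos (by norm_num), hE]
    nth_rewrite 1 [← Real.exp_log hs0]
    rw [← Real.exp_add]
    apply Real.exp_le_exp.2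
    linarith
  have hcount : N.factorial ≤ Nat.card {π : Equiv.Perm (Fin N) //
      ∀ j < s, (((clusterBlock N k j π) ∩ A).card : ℝ) < ξ * k}
      + ∑ j ∈ Finset.range s, (bad j).card := by
    rw [Nat.card_eq_fintype_card, Fintype.card_subtype]
    have hc : (Finset.univ : Finset (Equiv.Perm (Fin N))).card = N.factorial := by
      rw [Finset.card_univ, Fintype.card_perm, Fintype.card_fin]
    rw [← hc]
    refine le_trans ?_ (Nat.add_le_add_left Finset.card_biUnion_le _)
    refine le_trans (Finset.card_le_card ?_) (Finset.card_union_le _ _)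
    intro π _
    simp only [Finset.mem_union, Finset.mem_filter, Finset.mem_univ, true_and,
      Finset.mem_biUnion, Finset.mem_range, hbad]
    by_contra! h
    obtain ⟨⟨j, hj, hj1⟩, h2⟩ := h
    exact absurd hj1 (not_le.2 (h2 j hj))
  have hcount' : (N.factorial : ℝ) ≤ (Nat.card {π : Equiv.Perm (Fin N) //
      ∀ j < s, (((clusterBlock N k j π) ∩ A).card : ℝ) < ξ * k} : ℝ)
      + ∑ j ∈ Finset.range s, ((bad j).card : ℝ) := by exact_mod_cast hcount
  have hsum : ∑ j ∈ Finset.range s, ((bad j).card : ℝ) ≤ s * (E * N.factorial) := by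
    have := Finset.sum_le_card_nsmul (Finset.range s) (fun j => ((bad j).card : ℝ)) _
      (fun j _ => hb j)
    simpa using this
  have : (s : ℝ) * E * N.factorial ≤ (2 : ℝ) ^ (-σ) * N.factorial := by gcongr
  linarith
end

section
/- (Shamir correctness, Lemma 2, with the exponent as in the proof.) Let N = s·k with s, k ≥ 1, let δ, ξ, ζ ≥ 0 and η ≥ 0 be reals with δ + ξ + ζ < 1, and let D ⊆ Fin N be any subset with |D| ≤ δ·N. Partition Fin N uniformly at random into s clusters of size k (via a uniformly random permutation of Fin N, taking consecutive index blocks of length k as clusters). If 2·(1 − δ − ξ − ζ)²·k + ln k − ln N − η·ln 2 ≥ 0, then with probability at least 1 − 2^{−η}, every cluster c satisfies |c ∩ D| ≤ k − ξ·k − ζ·k; consequently, for any set Q of unlearned users containing at most ζ·k users per cluster, every cluster retains at least t = ξ·k users outside D ∪ Q. -/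
open Finset MeasureTheory ProbabilityTheory in
theorem sc_bern (p t : ℝ) (hp : 0 ≤ p) (hp1 : p ≤ 1) :
    1 + p * (Real.exp t - 1) ≤ Real.exp (t * p + t ^ 2 / 8) := by
  let μ : Measure ℝ := ENNReal.ofReal p • Measure.dirac 1 + ENNReal.ofReal (1 - p) • Measure.dirac 0
  have hμ : IsProbabilityMeasure μ := by
    constructor
    simp only [μ, Measure.add_apply, Measure.smul_apply, measure_univ, smul_eq_mul, mul_one]
    rw [← ENNReal.ofReal_add hp (by linarith)]
    simp
  have hint : ∀ f : ℝ → ℝ, ∫ x, f x ∂μ = p * f 1 + (1 - p) * f 0 := by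
    intro f
    have i1 : Integrable f (ENNReal.ofReal p • Measure.dirac (1:ℝ)) :=
      (integrable_dirac (by simp)).smul_measure (by simp)
    have i2 : Integrable f (ENNReal.ofReal (1 - p) • Measure.dirac (0:ℝ)) :=
      (integrable_dirac (by simp)).smul_measure (by simp)
    rw [integral_add_measure i1 i2, integral_smul_measure, integral_smul_measure,
      integral_dirac, integral_dirac, ENNReal.toReal_ofReal hp,
      ENNReal.toReal_ofReal (by linarith)]
    simp
  have hb : ∀ᵐ x ∂μ, (id x : ℝ) ∈ Set.Icc (0:ℝ) 1 := by
    rw [ae_add_measure_iff]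
    constructor
    · apply Measure.ae_smul_measure
      simp [ae_dirac_eq]
    · apply Measure.ae_smul_measure
      simp [ae_dirac_eq]
  have h := (hasSubgaussianMGF_of_mem_Icc (μ := μ) (X := id) aemeasurable_id hb).mgf_le t
  have hm : ∫ x, id x ∂μ = p := by rw [hint]; simp
  rw [hm] at h
  unfold mgf at h
  rw [hint] at h
  have e : (((‖(1:ℝ) - 0‖₊ / 2) ^ 2 : NNReal) : ℝ) * t ^ 2 / 2 = t ^ 2 / 8 := by
    simp; ring
  rw [e] at h
  simp only [id] at h
  rw [Real.exp_add]
  have h2 := mul_le_mul_of_nonneg_left h (Real.exp_pos (t * p)).le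
  refine le_trans (le_of_eq ?_) h2
  have e1 : Real.exp (t * p) * Real.exp (t * (1 - p)) = Real.exp t := by
    rw [← Real.exp_add]; ring_nf
  have e2 : Real.exp (t * p) * Real.exp (t * (0 - p)) = 1 := by
    rw [← Real.exp_add]; ring_nf; simp
  linear_combination (-p) * e1 - (1 - p) * e2

/-- number of permutations sending T into D -/
def scF {N : ℕ} (D T : Finset (Fin N)) : Finset (Equiv.Perm (Fin N)) :=
  Finset.univ.filter fun π => ∀ i ∈ T, π i ∈ D

theorem scF_swap {N : ℕ} (D T : Finset (Fin N)) (a b : Fin N) (ha : a ∉ T) (hb : b ∉ T) :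
    (scF D (insert a T)).card = (scF D (insert b T)).card := by
  have key : ∀ i ∈ T, Equiv.swap a b i = i := fun i hi =>
    Equiv.swap_apply_of_ne_of_ne (by rintro rfl; exact ha hi) (by rintro rfl; exact hb hi)
  refine Finset.card_bij' (fun π _ => π * Equiv.swap a b) (fun π _ => π * Equiv.swap a b) ?_ ?_ ?_ ?_
  · intro π hπ
    simp only [scF, Finset.mem_filter, Finset.mem_univ, true_and, Finset.forall_mem_insert,
      Equiv.Perm.mul_apply, Equiv.swap_apply_right] at hπ ⊢
    refine ⟨hπ.1, fun i hi => ?_⟩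
    rw [key i hi]; exact hπ.2 i hi
  · intro π hπ
    simp only [scF, Finset.mem_filter, Finset.mem_univ, true_and, Finset.forall_mem_insert,
      Equiv.Perm.mul_apply, Equiv.swap_apply_left] at hπ ⊢
    refine ⟨hπ.1, fun i hi => ?_⟩
    rw [key i hi]; exact hπ.2 i hi
  · intro π _; simp [mul_assoc]
  · intro π _; simp [mul_assoc]

theorem scF_step {N : ℕ} (D T : Finset (Fin N)) (a : Fin N) (ha : a ∉ T) :
    ((scF D (insert a T)).card : ℝ) * N ≤ (scF D T).card * D.card := by
  have h1 : ∑ b ∈ Tᶜ, (scF D (insert b T)).card = Tᶜ.card * (scF D (insert a T)).card := by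
    rw [Finset.sum_const_nat]
    intro b hb
    exact scF_swap D T b a (by simpa using hb) ha
  have h2 : ∑ b ∈ Tᶜ, (scF D (insert b T)).card
      = ∑ π ∈ scF D T, (Tᶜ.filter fun b => π b ∈ D).card := by
    have : ∀ b, scF D (insert b T) = (scF D T).filter fun π => π b ∈ D := by
      intro b; ext π; simp [scF, and_comm]
    simp_rw [this, Finset.card_filter]
    rw [Finset.sum_comm]
  have h3 : ∀ π ∈ scF D T, ((Tᶜ.filter fun b => π b ∈ D).card : ℝ) = D.card - T.card := by
    intro π hπ
    simp only [scF, Finset.mem_filter, Finset.mem_univ, true_and] at hπ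
    have e : (Tᶜ.filter fun b => π b ∈ D) = (D.map π.symm.toEmbedding) \ T := by
      ext b; simp [and_comm]
    have hs : T ⊆ D.map π.symm.toEmbedding := by
      intro b hb; simpa using hπ b hb
    rw [e, Finset.card_sdiff_of_subset hs, Nat.cast_sub (Finset.card_le_card hs), Finset.card_map]
  have h4 : (Tᶜ.card : ℝ) = N - T.card := by
    rw [Finset.card_compl, Nat.cast_sub (Finset.card_le_univ T)]; simp
  have h5 : ((N:ℝ) - T.card) * (scF D (insert a T)).card = (scF D T).card * (D.card - T.card) := by
    rw [← h4]
    have := h1.symm.trans h2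
    have h' : ((Tᶜ.card * (scF D (insert a T)).card : ℕ) : ℝ)
      = ((∑ π ∈ scF D T, (Tᶜ.filter fun b => π b ∈ D).card : ℕ) : ℝ) := by rw [this]
    push_cast at h'
    rw [h', Finset.sum_congr rfl h3, Finset.sum_const, nsmul_eq_mul]
  have hpos : 0 < (N:ℝ) - T.card := by
    rw [← h4]
    exact_mod_cast Finset.card_pos.mpr ⟨a, by simpa using ha⟩
  have hDN : (D.card : ℝ) ≤ N := by
    have := Finset.card_le_univ D
    simp at this; exact_mod_cast this
  refine le_of_mul_le_mul_left ?_ hpos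
  calc ((N:ℝ) - T.card) * ((scF D (insert a T)).card * N)
      = (scF D T).card * ((D.card - T.card) * N) := by rw [← mul_assoc, h5]; ring
    _ ≤ (scF D T).card * ((N - T.card) * D.card) := by
        apply mul_le_mul_of_nonneg_left _ (by positivity)
        nlinarith [mul_nonneg (Nat.cast_nonneg (α := ℝ) T.card) (sub_nonneg.2 hDN)]
    _ = _ := by ring

theorem scF_bound {N : ℕ} (hN : 0 < N) (δ : ℝ) (D : Finset (Fin N))
    (hD : (D.card : ℝ) ≤ δ * N) (hδ : 0 ≤ δ) (T : Finset (Fin N)) :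
    ((scF D T).card : ℝ) ≤ N.factorial * δ ^ T.card := by
  induction T using Finset.induction_on with
  | empty => simp [scF, Fintype.card_perm]
  | insert a T ha ih =>
    have h := scF_step D T a ha
    have hN' : (0:ℝ) < N := by exact_mod_cast hN
    refine le_of_mul_le_mul_right ?_ hN'
    rw [Finset.card_insert_of_notMem ha, pow_succ]
    calc _ ≤ _ := h
      _ ≤ (scF D T).card * (δ * N) := by gcongr
      _ ≤ (N.factorial * δ ^ T.card) * (δ * N) := by gcongr
      _ = _ := by ring

theorem sc_mgf {N : ℕ} (hN : 0 < N) (δ w : ℝ) (D : Finset (Fin N)) (hw : 0 ≤ w)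
    (hD : (D.card : ℝ) ≤ δ * N) (hδ : 0 ≤ δ) (I : Finset (Fin N)) :
    ∑ π : Equiv.Perm (Fin N), (1 + w) ^ ((I.image π) ∩ D).card
      ≤ N.factorial * (1 + δ * w) ^ I.card := by
  have h1 : ∀ π : Equiv.Perm (Fin N), (1 + w) ^ ((I.image π) ∩ D).card
      = ∑ T ∈ I.powerset, if (∀ i ∈ T, π i ∈ D) then w ^ T.card else 0 := by
    intro π
    have e : ((I.image π) ∩ D).card = (I.filter fun i => π i ∈ D).card := by
      rw [← Finset.filter_mem_eq_inter, Finset.filter_image,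
        Finset.card_image_of_injective _ π.injective]
    have e2 : (1 + w) ^ (I.filter fun i => π i ∈ D).card
        = ∏ i ∈ I, (1 + if π i ∈ D then w else 0) := by
      rw [← Finset.prod_const, Finset.prod_filter]
      refine Finset.prod_congr rfl fun i _ => ?_
      split_ifs <;> simp
    rw [e, e2, Finset.prod_one_add]
    refine Finset.sum_congr rfl fun T _ => ?_
    rw [Finset.prod_ite_zero]; simp
  simp_rw [h1]
  rw [Finset.sum_comm, add_comm, ← Finset.sum_pow_mul_eq_add_pow, Finset.mul_sum]
  refine Finset.sum_le_sum fun T _ => ?_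
  rw [← Finset.sum_filter, Finset.sum_const, nsmul_eq_mul, one_pow, mul_one, mul_pow]
  have := scF_bound hN δ D hD hδ T
  calc _ ≤ (N.factorial * δ ^ T.card) * w ^ T.card :=
        mul_le_mul_of_nonneg_right this (by positivity)
    _ = _ := by ring

theorem sc_tail {N : ℕ} (hN : 0 < N) (δ ε : ℝ) (D : Finset (Fin N)) (hε : 0 ≤ ε)
    (hD : (D.card : ℝ) ≤ δ * N) (hδ : 0 ≤ δ) (hδ1 : δ ≤ 1) (I : Finset (Fin N)) :
    ((Finset.univ.filter fun π : Equiv.Perm (Fin N) =>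
      (δ + ε) * I.card < (((I.image π) ∩ D).card : ℝ)).card : ℝ)
      ≤ N.factorial * Real.exp (-(2 * ε ^ 2 * I.card)) := by
  have h1 := sc_mgf hN δ (Real.exp (4 * ε) - 1) D
    (by have := Real.add_one_le_exp (4 * ε); linarith) hD hδ I
  have h2 : (1 + δ * (Real.exp (4 * ε) - 1)) ^ I.card
      ≤ Real.exp (I.card * (4 * ε * δ + (4 * ε) ^ 2 / 8)) := by
    rw [Real.exp_nat_mul]
    refine pow_le_pow_left₀ ?_ (sc_bern δ (4 * ε) hδ hδ1) _
    have := Real.add_one_le_exp (4 * ε)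
    have : 0 ≤ δ * (Real.exp (4 * ε) - 1) := mul_nonneg hδ (by linarith)
    linarith
  set B := (Finset.univ.filter fun π : Equiv.Perm (Fin N) =>
      (δ + ε) * I.card < (((I.image π) ∩ D).card : ℝ)) with hB
  have h3 : (B.card : ℝ) * Real.exp (4 * ε * ((δ + ε) * I.card)) ≤
      ∑ π : Equiv.Perm (Fin N), (1 + (Real.exp (4 * ε) - 1)) ^ ((I.image π) ∩ D).card := by
    rw [← nsmul_eq_mul]
    refine (Finset.card_nsmul_le_sum B _ _ ?_).trans
      (Finset.sum_le_sum_of_subset_of_nonneg (Finset.subset_univ B) ?_)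
    · intro π hπ
      rw [hB, Finset.mem_filter] at hπ
      rw [add_sub_cancel, ← Real.exp_nat_mul, Real.exp_le_exp]
      nlinarith [hπ.2]
    · intro π _ _
      rw [add_sub_cancel]; positivity
  have h4 := h3.trans (h1.trans (mul_le_mul_of_nonneg_left h2 (by positivity)))
  refine le_of_mul_le_mul_right (h4.trans (le_of_eq ?_)) (Real.exp_pos (4 * ε * ((δ + ε) * I.card)))
  rw [mul_assoc (N.factorial : ℝ), ← Real.exp_add]
  ring_nf

theorem sc_card (s k N j : ℕ) (hN : N = s * k) (hj : j < s) :
    (Finset.univ.filter fun i : Fin N => j * k ≤ (i : ℕ) ∧ (i : ℕ) < (j + 1) * k).card = k := by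
  have h : (j + 1) * k ≤ N := by rw [hN]; exact Nat.mul_le_mul_right k hj
  rw [← Finset.card_map Fin.valEmbedding]
  have : (Finset.univ.filter fun i : Fin N => j * k ≤ (i : ℕ) ∧ (i : ℕ) < (j + 1) * k).map
      Fin.valEmbedding = Finset.Ico (j * k) ((j + 1) * k) := by
    ext x
    simp only [Finset.mem_map, Finset.mem_filter, Finset.mem_univ, true_and, Finset.mem_Ico,
      Fin.valEmbedding_apply]
    constructor
    · rintro ⟨y, hy, rfl⟩; exact hy
    · intro hx; exact ⟨⟨x, by omega⟩, hx, rfl⟩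
  rw [this, Nat.card_Ico, Nat.succ_mul]; omega

/-- Shamir correctness (Lemma 2): if `|D| ≤ δ·N`, `δ + ξ + ζ < 1`, and
`2(1−δ−ξ−ζ)²k + ln k − ln N − η ln 2 ≥ 0`, then a uniformly random partition of
`Fin N` into `s` clusters of size `k` satisfies, with probability at least
`1 − 2^{−η}`, that every cluster `c` has `|c ∩ D| ≤ k − ξk − ζk`; consequently,
for any set `Q` of unlearned users containing at most `ζ·k` users per cluster,
every cluster retains at least `t = ξ·k` users outside `D ∪ Q`. -/
theorem shamir_correctness
    (s k N : ℕ) (hN : N = s * k) (hs : 1 ≤ s) (hk : 1 ≤ k)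
    (δ ξ ζ η : ℝ) (hδ : 0 ≤ δ) (hξ : 0 ≤ ξ) (hζ : 0 ≤ ζ) (hη : 0 ≤ η)
    (hsum : δ + ξ + ζ < 1)
    (D : Finset (Fin N)) (hD : (D.card : ℝ) ≤ δ * N)
    (hcond : 2 * (1 - δ - ξ - ζ) ^ 2 * k + Real.log k - Real.log N - η * Real.log 2 ≥ 0) :
    (1 - (2 : ℝ) ^ (-η)) * (N.factorial : ℝ)
      ≤ (Nat.card {π : Equiv.Perm (Fin N) //
          (∀ j < s, (((clusterBlock N k j π) ∩ D).card : ℝ) ≤ (k : ℝ) - ξ * k - ζ * k)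
          ∧ ∀ Q : Finset (Fin N),
              (∀ j < s, (((clusterBlock N k j π) ∩ Q).card : ℝ) ≤ ζ * k) →
              ∀ j < s, ξ * k ≤ (((clusterBlock N k j π) \ (D ∪ Q)).card : ℝ)} : ℝ) := by
  classical
  have hNpos : 0 < N := by rw [hN]; positivity
  have hbl : ∀ j < s, ∀ π, (clusterBlock N k j π).card = k := by
    intro j hj π
    rw [clusterBlock, Finset.card_image_of_injective _ π.injective, sc_card s k N j hN hj]
  set ε := 1 - δ - ξ - ζ with hε
  let B : ℕ → Finset (Equiv.Perm (Fin N)) := fun j => Finset.univ.filter fun π =>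
    (k : ℝ) - ξ * k - ζ * k < (((clusterBlock N k j π) ∩ D).card : ℝ)
  have hB : ∀ j ∈ Finset.range s, ((B j).card : ℝ)
      ≤ N.factorial * Real.exp (-(2 * ε ^ 2 * k)) := by
    intro j hj
    have h := sc_tail hNpos δ ε D (by linarith) hD hδ (by linarith)
      (Finset.univ.filter fun i : Fin N => j * k ≤ (i : ℕ) ∧ (i : ℕ) < (j + 1) * k)
    rw [sc_card s k N j hN (Finset.mem_range.1 hj)] at h
    have e : (δ + ε) * (k:ℝ) = (k : ℝ) - ξ * k - ζ * k := by rw [hε]; ring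
    rw [e] at h
    exact h
  let G : Finset (Equiv.Perm (Fin N)) := ((Finset.range s).biUnion B)ᶜ
  have hG : (N.factorial : ℝ) - s * (N.factorial * Real.exp (-(2 * ε ^ 2 * k))) ≤ G.card := by
    have h1 : (((Finset.range s).biUnion B).card : ℝ) ≤
        s * (N.factorial * Real.exp (-(2 * ε ^ 2 * k))) := by
      calc (((Finset.range s).biUnion B).card : ℝ) ≤ ∑ j ∈ Finset.range s, ((B j).card : ℝ) := by
            exact_mod_cast Finset.card_biUnion_le
        _ ≤ ∑ j ∈ Finset.range s, (N.factorial * Real.exp (-(2 * ε ^ 2 * k))) :=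
            Finset.sum_le_sum hB
        _ = _ := by simp
    have h2 := Finset.card_compl_add_card ((Finset.range s).biUnion B)
    rw [Fintype.card_perm, Fintype.card_fin] at h2
    have h3 : (G.card : ℝ) + (((Finset.range s).biUnion B).card : ℝ) = N.factorial := by
      exact_mod_cast h2
    linarith
  have hexp : (s : ℝ) * Real.exp (-(2 * ε ^ 2 * k)) ≤ (2:ℝ) ^ (-η) := by
    have hs0 : (0:ℝ) < s := by exact_mod_cast hs
    have hk0 : (0:ℝ) < k := by exact_mod_cast hk
    have hl : Real.log N = Real.log s + Real.log k := by
      rw [hN]; push_cast; exact Real.log_mul hs0.ne' hk0.ne'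
    rw [Real.rpow_def_of_pos (by norm_num)]
    nth_rw 1 [← Real.exp_log hs0]
    rw [← Real.exp_add, Real.exp_le_exp]
    linarith
  have hsub : G.card ≤ Nat.card {π : Equiv.Perm (Fin N) //
          (∀ j < s, (((clusterBlock N k j π) ∩ D).card : ℝ) ≤ (k : ℝ) - ξ * k - ζ * k)
          ∧ ∀ Q : Finset (Fin N),
              (∀ j < s, (((clusterBlock N k j π) ∩ Q).card : ℝ) ≤ ζ * k) →
              ∀ j < s, ξ * k ≤ (((clusterBlock N k j π) \ (D ∪ Q)).card : ℝ)} := by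
    rw [Nat.card_eq_fintype_card, Fintype.card_subtype]
    refine Finset.card_le_card fun π hπ => ?_
    have h1 : ∀ j < s, (((clusterBlock N k j π) ∩ D).card : ℝ) ≤ (k : ℝ) - ξ * k - ζ * k := by
      intro j hj
      by_contra hc
      apply Finset.mem_compl.1 hπ
      exact Finset.mem_biUnion.2 ⟨j, Finset.mem_range.2 hj,
        Finset.mem_filter.2 ⟨Finset.mem_univ _, not_le.1 hc⟩⟩
    refine Finset.mem_filter.2 ⟨Finset.mem_univ _, h1, fun Q hQ j hj => ?_⟩
    have a1 := h1 j hj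
    have a2 := hQ j hj
    have a3 := Finset.card_sdiff_add_card_inter (clusterBlock N k j π) (D ∪ Q)
    rw [hbl j hj, Finset.inter_union_distrib_left] at a3
    have a4 := Finset.card_union_le (clusterBlock N k j π ∩ D) (clusterBlock N k j π ∩ Q)
    have a5 : (k : ℝ) ≤ ((clusterBlock N k j π) \ (D ∪ Q)).card
        + ((clusterBlock N k j π ∩ D).card + (clusterBlock N k j π ∩ Q).card) := by
      exact_mod_cast (by omega)
    linarith
  refine le_trans ?_ (hG.trans (by exact_mod_cast hsub))
  have := mul_le_mul_of_nonneg_right hexp (Nat.cast_nonneg (α := ℝ) N.factorial)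
  linarith
end

section
/- Let k > h ≥ 1 be integers and let G be the circulant graph on vertex set ZMod k in which distinct vertices i and j are adjacent if and only if i − j ∈ {±1, ±2, …, ±h} (the (k, m) Harary graph with m = 2h). Let F ⊆ ZMod k be a vertex set whose complement is nonempty and which contains no h consecutive vertices; that is, for every i ∈ ZMod k there exists 0 ≤ j < h with i + j ∉ F. Then the subgraph of G induced on the complement of F is connected. -/
/-- The `(k, 2h)` Harary graph: the circulant graph on `ZMod k` in which
distinct vertices `i` and `j` are adjacent iff `i − j ∈ {±1, …, ±h}`. -/
def hararyGraph (k h : ℕ) : SimpleGraph (ZMod k) :=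
  SimpleGraph.fromRel fun i j => ∃ d : ℕ, 1 ≤ d ∧ d ≤ h ∧ i - j = (d : ZMod k)

theorem harary_step (k h : ℕ) (F : Set (ZMod k)) (u v : (Fᶜ : Set (ZMod k))) (d : ℕ)
    (hd : d ≤ h) (huv : (v : ZMod k) = u + (d : ZMod k)) :
    ((hararyGraph k h).induce Fᶜ).Reachable u v := by
  by_cases huv' : u = v
  · rw [huv']
  · apply SimpleGraph.Adj.reachable
    have hne : (u : ZMod k) ≠ v := fun e => huv' (Subtype.ext e)
    have hd0 : 1 ≤ d := by
      rcases Nat.eq_zero_or_pos d with h0 | h0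
      · subst h0
        exact absurd (by simpa using huv.symm) hne
      · exact h0
    rw [SimpleGraph.comap_adj]
    unfold hararyGraph
    rw [SimpleGraph.fromRel_adj]
    exact ⟨hne, Or.inr ⟨d, hd0, hd, by simp [huv]⟩⟩

theorem harary_reach (k h : ℕ) (F : Set (ZMod k))
    (hcons : ∀ i : ZMod k, ∃ j : ℕ, j < h ∧ i + (j : ZMod k) ∉ F) (n : ℕ) :
    ∀ u v : (Fᶜ : Set (ZMod k)), (v : ZMod k) = u + (n : ZMod k) →
      ((hararyGraph k h).induce Fᶜ).Reachable u v := by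
  induction n using Nat.strong_induction_on with
  | _ n ih =>
    intro u v huv
    by_cases hn : n ≤ h
    · exact harary_step k h F u v n hn huv
    · obtain ⟨j, hj, hjF⟩ := hcons (u + 1)
      let w : (Fᶜ : Set (ZMod k)) := ⟨(u : ZMod k) + 1 + (j : ZMod k), hjF⟩
      refine (harary_step k h F u w (j + 1) (by omega) ?_).trans
        (ih (n - (j + 1)) (by omega) w v ?_)
      · simp only [w]; push_cast; ring
      · rw [huv, Nat.cast_sub (by omega)]
        simp only [w]; push_cast; ring

/-- If `F ⊆ ZMod k` has nonempty complement and contains no `h` consecutive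
vertices (for every `i` there is `0 ≤ j < h` with `i + j ∉ F`), then the
subgraph of the `(k, 2h)` Harary graph induced on the complement of `F` is
connected. -/
theorem harary_induced_connected_of_no_consecutive
    (k h : ℕ) (hh : 1 ≤ h) (hk : h < k)
    (F : Set (ZMod k)) (hne : Fᶜ.Nonempty)
    (hcons : ∀ i : ZMod k, ∃ j : ℕ, j < h ∧ i + (j : ZMod k) ∉ F) :
    ((hararyGraph k h).induce Fᶜ).Connected := by
  haveI : NeZero k := ⟨by omega⟩
  haveI : Nonempty (Fᶜ : Set (ZMod k)) := hne.to_subtype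
  refine SimpleGraph.Connected.mk fun u v => ?_
  refine harary_reach k h F hcons ((v : ZMod k) - u).val u v ?_
  simp
end

section
/- Let k > m ≥ 2 be integers with m even, m = 2h, and let G be the circulant graph on vertex set ZMod k in which distinct vertices i and j are adjacent if and only if i − j ∈ {±1, ±2, …, ±h} (the (k, m) Harary graph). Then G is m-vertex-connected: for every vertex subset F ⊆ ZMod k with |F| ≤ m − 1, the subgraph of G induced on the complement of F is connected. -/
theorem harary_aux (k h : ℕ) (F : Set (ZMod k)) (x : ZMod k) (a : ℕ)
    (ha : x + (a : ZMod k) ∈ Fᶜ) (S : Finset ℕ) (hS : S.card < h) (b : ℕ)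
    (hSF : ∀ i, a ≤ i → i < b → x + (i : ZMod k) ∈ F → i ∈ S) :
    ∀ j, a ≤ j → j ≤ b → ∀ hj : x + (j : ZMod k) ∈ Fᶜ,
      ((hararyGraph k h).induce Fᶜ).Reachable ⟨x + (a : ZMod k), ha⟩ ⟨x + (j : ZMod k), hj⟩ := by
  have step : ∀ i d : ℕ, 1 ≤ d → d ≤ h → ∀ (hi : x + (i : ZMod k) ∈ Fᶜ)
      (hj : x + ((i + d : ℕ) : ZMod k) ∈ Fᶜ),
      ((hararyGraph k h).induce Fᶜ).Reachable ⟨x + (i : ZMod k), hi⟩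
        ⟨x + ((i + d : ℕ) : ZMod k), hj⟩ := by
    intro i d h1 h2 hi hj
    by_cases he : x + (i : ZMod k) = x + ((i + d : ℕ) : ZMod k)
    · have : (⟨x + (i : ZMod k), hi⟩ : (Fᶜ : Set (ZMod k))) = ⟨x + ((i + d : ℕ) : ZMod k), hj⟩ :=
        Subtype.ext he
      rw [this]
    · apply SimpleGraph.Adj.reachable
      rw [SimpleGraph.induce_adj]
      unfold hararyGraph
      rw [SimpleGraph.fromRel_adj]
      refine ⟨he, Or.inr ⟨d, h1, h2, ?_⟩⟩
      push_cast
      ring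
  intro j
  induction j using Nat.strong_induction_on with
  | _ j ih =>
    intro haj hjb hj
    rcases Nat.eq_or_lt_of_le haj with rfl | hlt
    · exact SimpleGraph.Reachable.refl _
    by_cases hle : j ≤ a + h
    · obtain ⟨d, rfl⟩ := Nat.exists_eq_add_of_lt hlt
      exact step a (d + 1) (by omega) (by omega) ha hj
    · obtain ⟨i, hi1, hi2, hi⟩ : ∃ i, j - h ≤ i ∧ i < j ∧ x + (i : ZMod k) ∉ F := by
        by_contra! hcon
        have hsub : Finset.Ico (j - h) j ⊆ S := by
          intro i hi
          rw [Finset.mem_Ico] at hi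
          exact hSF i (by omega) (by omega) (hcon i hi.1 hi.2)
        have := Finset.card_le_card hsub
        rw [Nat.card_Ico] at this
        omega
      refine (ih i hi2 (by omega) (by omega) hi).trans ?_
      obtain ⟨d, rfl⟩ := Nat.exists_eq_add_of_lt hi2
      exact step i (d + 1) (by omega) (by omega) hi hj

/-- The `(k, m)` Harary graph with `m = 2h` even, `2 ≤ m < k`, is
`m`-vertex-connected: removing any set `F` of at most `m − 1` vertices leaves
the induced subgraph on the complement connected. -/
theorem harary_m_connected
    (k m h : ℕ) (hm : m = 2 * h) (h2 : 2 ≤ m) (hk : m < k)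
    (F : Set (ZMod k)) (hF : F.ncard ≤ m - 1) :
    ((hararyGraph k h).induce Fᶜ).Connected := by
  classical
  have : NeZero k := ⟨by omega⟩
  have hne : (Fᶜ : Set (ZMod k)).Nonempty := by
    rw [Set.nonempty_compl]
    rintro rfl
    rw [Set.ncard_univ, Nat.card_zmod] at hF
    omega
  have : Nonempty (Fᶜ : Set (ZMod k)) := hne.to_subtype
  refine ⟨?_⟩
  rintro ⟨x, hx⟩ ⟨y, hy⟩
  set n := (y - x).val with hn
  have hnk : n < k := ZMod.val_lt _
  have hyx : x + (n : ZMod k) = y := by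
    rw [hn, ZMod.natCast_zmod_val]; ring
  have h0 : x + ((0 : ℕ) : ZMod k) = x := by simp
  have hkx : x + (k : ZMod k) = x := by simp
  let A : Finset ℕ := (Finset.Ico 0 n).filter fun i : ℕ => x + (i : ZMod k) ∈ F
  let B : Finset ℕ := (Finset.Ico n k).filter fun i : ℕ => x + (i : ZMod k) ∈ F
  have hdis : Disjoint A B := by
    rw [Finset.disjoint_left]
    intro i hi hi'
    simp only [A, B, Finset.mem_filter, Finset.mem_Ico] at hi hi'
    omega
  have hcard : A.card + B.card ≤ F.ncard := by
    rw [← Finset.card_union_of_disjoint hdis, ← Set.ncard_coe_finset]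
    refine Set.ncard_le_ncard_of_injOn (fun i : ℕ => x + (i : ZMod k)) ?_ ?_ (Set.toFinite F)
    · intro i hi
      simp only [A, B, Finset.coe_union, Set.mem_union, Finset.mem_coe, Finset.mem_filter] at hi
      rcases hi with hi | hi <;> exact hi.2
    · intro i hi j hj hij
      have hi' : i < k := by
        simp only [A, B, Finset.coe_union, Set.mem_union, Finset.mem_coe, Finset.mem_filter,
          Finset.mem_Ico] at hi
        omega
      have hj' : j < k := by
        simp only [A, B, Finset.coe_union, Set.mem_union, Finset.mem_coe, Finset.mem_filter,
          Finset.mem_Ico] at hj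
        omega
      have := add_left_cancel hij
      rw [ZMod.natCast_eq_natCast_iff'] at this
      rwa [Nat.mod_eq_of_lt hi', Nat.mod_eq_of_lt hj'] at this
  rcases (show A.card < h ∨ B.card < h by omega) with hA | hB
  · have := harary_aux k h F x 0 (by rwa [h0]) A hA n
      (fun i h1 h2 h3 => by simp only [A, Finset.mem_filter, Finset.mem_Ico]; exact ⟨⟨h1, h2⟩, h3⟩)
      n (by omega) le_rfl (by rwa [hyx])
    convert this using 2
    · exact h0.symm
    · exact hyx.symm
  · have := harary_aux k h F x n (by rwa [hyx]) B hB k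
      (fun i h1 h2 h3 => by simp only [B, Finset.mem_filter, Finset.mem_Ico]; exact ⟨⟨h1, h2⟩, h3⟩)
      k (by omega) le_rfl (by rwa [hkx])
    refine SimpleGraph.Reachable.symm ?_
    convert this using 2
    · exact hyx.symm
    · exact hkx.symm
end

section
/- (Connectivity security, probabilistic core of Lemma 3.) Let k > h ≥ 1 be integers, let G be the circulant graph on ZMod k with connection set {±1, …, ±h} (the (k, m) Harary graph with m = 2h), and let 0 ≤ b < k. If F is a uniformly random b-element subset of ZMod k, then the probability that the subgraph of G induced on the complement of F is disconnected is at most k·(b/k)^h. In particular, if b = ρ·k for a real 0 ≤ ρ < 1, this probability is at most k·ρ^{m/2}. -/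
lemma harary_aux_reach (k h : ℕ) (F : Finset (ZMod k))
    (H : ∀ x : ZMod k, ∃ i : ℕ, 1 ≤ i ∧ i ≤ h ∧ x + (i : ZMod k) ∉ F) :
    ∀ n : ℕ, ∀ u v : ((↑F : Set (ZMod k))ᶜ : Set (ZMod k)), v.1 = u.1 + (n : ZMod k) →
      ((hararyGraph k h).induce ((↑F : Set (ZMod k))ᶜ)).Reachable u v := by
  have step : ∀ (u v : ((↑F : Set (ZMod k))ᶜ : Set (ZMod k))) (i : ℕ), 1 ≤ i → i ≤ h →
      v.1 = u.1 + (i : ZMod k) →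
      ((hararyGraph k h).induce ((↑F : Set (ZMod k))ᶜ)).Reachable u v := by
    intro u v i h1 h2 h3
    by_cases huv : u = v
    · subst huv
      exact SimpleGraph.Reachable.refl _
    · apply SimpleGraph.Adj.reachable
      rw [SimpleGraph.comap_adj]
      unfold hararyGraph
      rw [SimpleGraph.fromRel_adj]
      refine ⟨fun e => huv (Subtype.ext e), Or.inr ⟨i, h1, h2, ?_⟩⟩
      change v.1 - u.1 = _
      rw [h3]
      ring
  intro n
  induction n using Nat.strong_induction_on with
  | _ n ih =>
    intro u v huv
    rcases Nat.eq_zero_or_pos n with h0 | hpos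
    · subst h0
      have : u = v := by
        apply Subtype.ext
        rw [huv]
        simp
      subst this
      exact SimpleGraph.Reachable.refl _
    · by_cases hn : n ≤ h
      · exact step u v n hpos hn huv
      · obtain ⟨i, h1, h2, h3⟩ := H u.1
        have hw : u.1 + (i : ZMod k) ∈ ((↑F : Set (ZMod k))ᶜ : Set (ZMod k)) := by simpa using h3
        refine (step u ⟨_, hw⟩ i h1 h2 rfl).trans (ih (n - i) (by omega) ⟨_, hw⟩ v ?_)
        rw [huv, Nat.cast_sub (by omega)]
        ring

lemma harary_aux_exists (k h b : ℕ) [NeZero k] (hb : b < k) (F : Finset (ZMod k))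
    (hF : F.card = b)
    (hc : ¬ ((hararyGraph k h).induce ((↑F : Set (ZMod k))ᶜ)).Connected) :
    ∃ x : ZMod k, ∀ i : ℕ, 1 ≤ i → i ≤ h → x + (i : ZMod k) ∈ F := by
  by_contra hcon
  push Not at hcon
  apply hc
  rw [SimpleGraph.connected_iff]
  constructor
  · intro u v
    refine harary_aux_reach k h F hcon (v.1 - u.1).val u v ?_
    rw [ZMod.natCast_zmod_val]
    ring
  · have : ∃ x, x ∉ F := by
      by_contra hx
      push Not at hx
      have : F = Finset.univ := Finset.eq_univ_iff_forall.2 hx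
      rw [this, Finset.card_univ, ZMod.card] at hF
      omega
    obtain ⟨x, hx⟩ := this
    exact ⟨⟨x, by simpa using hx⟩⟩

lemma harary_aux_desc (b k : ℕ) (hb : b ≤ k) (h : ℕ) :
    b.descFactorial h * k ^ h ≤ b ^ h * k.descFactorial h := by
  induction h with
  | zero => simp
  | succ n ih =>
    rw [Nat.descFactorial_succ, Nat.descFactorial_succ, pow_succ, pow_succ]
    have h1 : (b - n) * k ≤ b * (k - n) := by
      rw [Nat.sub_mul, Nat.mul_sub]
      have : b * n ≤ n * k := by rw [mul_comm]; exact Nat.mul_le_mul_left _ hb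
      omega
    calc (b - n) * b.descFactorial n * (k ^ n * k)
        = (b.descFactorial n * k ^ n) * ((b - n) * k) := by ring
      _ ≤ (b ^ n * k.descFactorial n) * (b * (k - n)) := Nat.mul_le_mul ih h1
      _ = _ := by ring

lemma harary_aux_choose (b k : ℕ) (hb : b ≤ k) (h : ℕ) (hhb : h ≤ b) :
    (k - h).choose (b - h) * k ^ h ≤ b ^ h * k.choose b := by
  have e := Nat.choose_mul (n := k) hhb
  have d := harary_aux_desc b k hb h
  rw [Nat.descFactorial_eq_factorial_mul_choose, Nat.descFactorial_eq_factorial_mul_choose] at d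
  have d2 : b.choose h * k ^ h ≤ b ^ h * k.choose h := by
    apply Nat.le_of_mul_le_mul_left _ (Nat.factorial_pos h)
    calc _ = h.factorial * b.choose h * k ^ h := by ring
      _ ≤ _ := d
      _ = _ := by ring
  have hp : 0 < k.choose h := Nat.choose_pos (hhb.trans hb)
  apply Nat.le_of_mul_le_mul_left _ hp
  calc k.choose h * ((k - h).choose (b - h) * k ^ h)
      = (k.choose h * (k - h).choose (b - h)) * k ^ h := by ring
    _ = (k.choose b * b.choose h) * k ^ h := by rw [e]
    _ = k.choose b * (b.choose h * k ^ h) := by ring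
    _ ≤ k.choose b * (b ^ h * k.choose h) := Nat.mul_le_mul_left _ d2
    _ = _ := by ring

lemma harary_aux_count {α : Type*} [Fintype α] [DecidableEq α] (S : Finset α) (b : ℕ)
    (hb : b ≤ Fintype.card α) :
    ((Finset.univ.powersetCard b).filter (fun F : Finset α => S ⊆ F)).card
      * Fintype.card α ^ S.card ≤ b ^ S.card * (Fintype.card α).choose b := by
  by_cases hS : S.card ≤ b
  · refine le_trans (Nat.mul_le_mul_right _ ?_) (harary_aux_choose b _ hb S.card hS)
    have : (Finset.powersetCard (b - S.card) (Finset.univ \ S)).card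
        = (Fintype.card α - S.card).choose (b - S.card) := by
      rw [Finset.card_powersetCard, Finset.card_sdiff_of_subset (Finset.subset_univ _),
        Finset.card_univ]
    rw [← this]
    apply Finset.card_le_card_of_injOn (fun F => F \ S)
    · intro F hF
      simp only [Finset.coe_filter, Finset.mem_powersetCard, Set.mem_ofPred_eq] at hF
      simp only [Finset.mem_coe, Finset.mem_powersetCard]
      refine ⟨Finset.sdiff_subset_sdiff hF.1.1 subset_rfl, ?_⟩
      rw [Finset.card_sdiff_of_subset hF.2, hF.1.2]
    · intro F hF F' hF' e
      simp only [Finset.coe_filter, Finset.mem_powersetCard, Set.mem_ofPred_eq] at hF hF'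
      simp only at e
      rw [← Finset.sdiff_union_of_subset hF.2, e, Finset.sdiff_union_of_subset hF'.2]
  · have : (Finset.univ.powersetCard b).filter (fun F : Finset α => S ⊆ F) = ∅ := by
      apply Finset.filter_eq_empty_iff.2
      intro F hF hSF
      have := Finset.card_le_card hSF
      rw [(Finset.mem_powersetCard.1 hF).2] at this
      exact hS this
    rw [this]
    simp

lemma harary_aux_main (k h b : ℕ) [NeZero k] (hk : h < k) (hb : b < k) :
    Nat.card {F : Finset (ZMod k) // F.card = b ∧
          ¬ ((hararyGraph k h).induce ((↑F : Set (ZMod k))ᶜ)).Connected} * k ^ h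
      ≤ k * (b ^ h * k.choose b) := by
  classical
  let S : ZMod k → Finset (ZMod k) := fun x =>
    (Finset.Icc 1 h).image (fun i : ℕ => x + (i : ZMod k))
  have hS : ∀ x, (S x).card = h := by
    intro x
    rw [Finset.card_image_of_injOn, Nat.card_Icc, Nat.add_sub_cancel]
    intro i hi j hj e
    simp only [Finset.coe_Icc, Set.mem_Icc] at hi hj
    have e' : (i : ZMod k) = (j : ZMod k) := add_left_cancel e
    rw [ZMod.natCast_eq_natCast_iff'] at e'
    rwa [Nat.mod_eq_of_lt (by omega), Nat.mod_eq_of_lt (by omega)] at e'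
  let T : ZMod k → Finset (Finset (ZMod k)) := fun x =>
    (Finset.univ.powersetCard b).filter (fun F => S x ⊆ F)
  have hT : ∀ x, (T x).card * k ^ h ≤ b ^ h * k.choose b := by
    intro x
    have := harary_aux_count (S x) b (by rw [ZMod.card]; exact hb.le)
    rwa [hS, ZMod.card] at this
  rw [Nat.card_eq_fintype_card, Fintype.card_subtype]
  have hsub : (Finset.univ.filter fun F : Finset (ZMod k) => F.card = b ∧
      ¬ ((hararyGraph k h).induce ((↑F : Set (ZMod k))ᶜ)).Connected)
      ⊆ Finset.univ.biUnion T := by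
    intro F hF
    obtain ⟨h1, h2⟩ := (Finset.mem_filter.1 hF).2
    obtain ⟨x, hx⟩ := harary_aux_exists k h b hb F h1 h2
    refine Finset.mem_biUnion.2 ⟨x, Finset.mem_univ _, Finset.mem_filter.2
      ⟨Finset.mem_powersetCard.2 ⟨Finset.subset_univ _, h1⟩, ?_⟩⟩
    intro y hy
    obtain ⟨i, hi, rfl⟩ := Finset.mem_image.1 hy
    exact hx i (Finset.mem_Icc.1 hi).1 (Finset.mem_Icc.1 hi).2
  calc _ ≤ (∑ x, (T x).card) * k ^ h :=
        Nat.mul_le_mul_right _ ((Finset.card_le_card hsub).trans Finset.card_biUnion_le)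
    _ = ∑ x, (T x).card * k ^ h := Finset.sum_mul _ _ _
    _ ≤ ∑ _x : ZMod k, b ^ h * k.choose b := Finset.sum_le_sum fun x _ => hT x
    _ = _ := by rw [Finset.sum_const, Finset.card_univ, ZMod.card, smul_eq_mul]

/-- Connectivity security (probabilistic core of Lemma 3): for a uniformly
random `b`-element subset `F` of `ZMod k` with `0 ≤ b < k`, the probability
that the subgraph of the `(k, 2h)` Harary graph induced on the complement of
`F` is disconnected is at most `k·(b/k)^h`; in particular, if `b = ρ·k` with
`0 ≤ ρ < 1`, this probability is at most `k·ρ^{m/2}` (where `m = 2h`). -/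
theorem harary_random_removal_disconnect_prob
    (k h b : ℕ) [NeZero k] (hh : 1 ≤ h) (hk : h < k) (hb : b < k) :
    (Nat.card {F : Finset (ZMod k) // F.card = b ∧
          ¬ ((hararyGraph k h).induce ((↑F : Set (ZMod k))ᶜ)).Connected} : ℝ)
        / (k.choose b : ℝ)
      ≤ (k : ℝ) * ((b : ℝ) / (k : ℝ)) ^ h
    ∧ ∀ ρ : ℝ, 0 ≤ ρ → ρ < 1 → (b : ℝ) = ρ * k →
      (Nat.card {F : Finset (ZMod k) // F.card = b ∧
            ¬ ((hararyGraph k h).induce ((↑F : Set (ZMod k))ᶜ)).Connected} : ℝ)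
          / (k.choose b : ℝ)
        ≤ (k : ℝ) * ρ ^ h := by
  have hk0 : (0 : ℝ) < k := by exact_mod_cast (by omega : 0 < k)
  have main : (Nat.card {F : Finset (ZMod k) // F.card = b ∧
          ¬ ((hararyGraph k h).induce ((↑F : Set (ZMod k))ᶜ)).Connected} : ℝ)
        / (k.choose b : ℝ)
      ≤ (k : ℝ) * ((b : ℝ) / (k : ℝ)) ^ h := by
    have hc : (0 : ℝ) < k.choose b := by exact_mod_cast Nat.choose_pos hb.le
    have hm : ((Nat.card {F : Finset (ZMod k) // F.card = b ∧
          ¬ ((hararyGraph k h).induce ((↑F : Set (ZMod k))ᶜ)).Connected} : ℕ) : ℝ)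
          * (k : ℝ) ^ h ≤ k * ((b : ℝ) ^ h * k.choose b) := by
      exact_mod_cast harary_aux_main k h b hk hb
    rw [div_le_iff₀ hc, div_pow, ← mul_div_assoc, div_mul_eq_mul_div,
      le_div_iff₀ (pow_pos hk0 h), mul_assoc (k : ℝ)]
    exact hm
  refine ⟨main, fun ρ _ _ hρ => ?_⟩
  have e : (b : ℝ) / k = ρ := by rw [hρ]; field_simp
  rw [← e]
  exact main
end

section
/- (Unlearning capacity guarantee.) Let s ≥ 1 and τ ≥ 1 be integers, σ ≥ 0 a real, and let f be a uniformly random function from Fin τ to Fin s with cluster loads q_i = |{ j : f(j) = i }|. If the real threshold q satisfies q ≥ τ/s + sqrt( (τ/2)·(ln s + σ·ln 2) ), then the probability that there exists i ∈ Fin s with q_i ≥ q is at most 2^{−σ}; i.e., with probability at least 1 − 2^{−σ} no cluster receives q or more unlearning requests. -/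
open MeasureTheory ProbabilityTheory in
lemma sum_exp_le (s : ℕ) (hs : 1 ≤ s) (i : Fin s) (t : ℝ) :
    ∑ a : Fin s, Real.exp (t * (if a = i then 1 else 0)) ≤
      s * Real.exp (t / s + t ^ 2 / 8) := by
  have hs0 : (0 : ℝ) < s := by exact_mod_cast hs
  haveI : Nonempty (Fin s) := ⟨i⟩
  let μ : Measure (Fin s) := (PMF.uniformOfFintype (Fin s)).toMeasure
  let X : Fin s → ℝ := fun a => if a = i then 1 else 0
  have hint : ∀ g : Fin s → ℝ, ∫ a, g a ∂μ = (∑ a, g a) / s := by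
    intro g
    simp only [μ]
    rw [PMF.integral_eq_sum]
    simp [← Finset.mul_sum, div_eq_inv_mul]
  have h := hasSubgaussianMGF_of_mem_Icc (μ := μ) (X := X) (a := 0) (b := 1)
    (measurable_of_finite X).aemeasurable
    (Filter.Eventually.of_forall (fun a => by simp only [X]; split_ifs <;> simp))
  have h2 := h.mgf_le t
  unfold mgf at h2
  rw [hint, hint] at h2
  have hX : ∑ a, X a = 1 := by simp [X]
  rw [hX] at h2
  have e : ∑ a, Real.exp (t * (X a - 1 / s)) =
      (∑ a, Real.exp (t * X a)) * Real.exp (-(t / s)) := by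
    rw [Finset.sum_mul]
    refine Finset.sum_congr rfl fun a _ => ?_
    rw [← Real.exp_add]; congr 1; ring
  rw [e, Real.exp_neg] at h2
  have hE := Real.exp_pos (t / s)
  have h3 : Real.exp (((((‖(1:ℝ) - 0‖₊ / 2) ^ 2 : NNReal)) : ℝ) * t ^ 2 / 2) = Real.exp (t ^ 2 / 8) := by
    congr 1
    simp
    ring
  rw [h3, div_le_iff₀ hs0, ← div_eq_mul_inv, div_le_iff₀ hE] at h2
  rw [Real.exp_add]
  calc _ ≤ _ := h2
    _ = _ := by ring

lemma card_mul_le (s τ : ℕ) (hs : 1 ≤ s) (i : Fin s) (t q : ℝ) (ht : 0 ≤ t) :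
    ((Finset.univ.filter fun f : Fin τ → Fin s =>
        q ≤ ((Finset.univ.filter fun j => f j = i).card : ℝ)).card : ℝ) * Real.exp (t * q) ≤
      (s * Real.exp (t / s + t ^ 2 / 8)) ^ τ := by
  refine le_trans ?_ (pow_le_pow_left₀ (Finset.sum_nonneg fun _ _ => (Real.exp_pos _).le)
    (sum_exp_le s hs i t) τ)
  rw [Fintype.sum_pow, ← nsmul_eq_mul]
  have key : ∀ f : Fin τ → Fin s, ∏ j, Real.exp (t * (if f j = i then 1 else 0)) =
      Real.exp (t * ((Finset.univ.filter fun j => f j = i).card : ℝ)) := by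
    intro f
    rw [← Real.exp_sum, ← Finset.mul_sum]
    simp
  simp only [key]
  refine le_trans (Finset.card_nsmul_le_sum _
    (fun f : Fin τ → Fin s => Real.exp (t * ((Finset.univ.filter fun j => f j = i).card : ℝ))) _ ?_)
    (Finset.sum_le_sum_of_subset_of_nonneg (Finset.filter_subset _ _)
      fun _ _ _ => (Real.exp_pos _).le)
  intro f hf
  have := (Finset.mem_filter.1 hf).2
  gcongr


/-- Unlearning capacity guarantee: for a uniformly random function
`f : Fin τ → Fin s` with loads `q_i = |{j : f j = i}|`, if the threshold `q`
satisfies `q ≥ τ/s + sqrt((τ/2)·(ln s + σ·ln 2))`, then the probability that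
some cluster receives at least `q` unlearning requests is at most `2^{−σ}`. -/
theorem unlearning_capacity_guarantee
    (s τ : ℕ) (hs : 1 ≤ s) (hτ : 1 ≤ τ) (σ : ℝ) (hσ : 0 ≤ σ) (q : ℝ)
    (hq : (τ : ℝ) / s + Real.sqrt (((τ : ℝ) / 2) * (Real.log s + σ * Real.log 2)) ≤ q) :
    (Nat.card {f : Fin τ → Fin s // ∃ i : Fin s,
        q ≤ ((Finset.univ.filter fun j => f j = i).card : ℝ)} : ℝ) / ((s : ℝ) ^ τ)
      ≤ (2 : ℝ) ^ (-σ) := by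
  classical
  have hs0 : (0 : ℝ) < s := by exact_mod_cast hs
  have hτ0 : (0 : ℝ) < τ := by exact_mod_cast hτ
  set L := Real.log s + σ * Real.log 2 with hL
  have hL0 : 0 ≤ L := by
    have h1 : 0 ≤ Real.log s := Real.log_nonneg (by exact_mod_cast hs)
    have h2 : 0 ≤ Real.log 2 := Real.log_nonneg (by norm_num)
    positivity
  set ε := Real.sqrt ((τ : ℝ) / 2 * L) with hε
  have hε0 : 0 ≤ ε := Real.sqrt_nonneg _
  have hε2 : ε ^ 2 = (τ : ℝ) / 2 * L := Real.sq_sqrt (by positivity)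
  have hexp : Real.exp (-L) = (2 : ℝ) ^ (-σ) / s := by
    rw [Real.rpow_def_of_pos (by norm_num), hL, neg_add, Real.exp_add, Real.exp_neg, Real.exp_log hs0]
    rw [show -(σ * Real.log 2) = Real.log 2 * -σ by ring]
    ring
  have hone : ∀ i : Fin s, ((Finset.univ.filter fun f : Fin τ → Fin s =>
        q ≤ ((Finset.univ.filter fun j => f j = i).card : ℝ)).card : ℝ) ≤
        (s : ℝ) ^ τ * ((2 : ℝ) ^ (-σ) / s) := by
    intro i
    have ht : 0 ≤ 4 * ε / τ := by positivity
    have h := card_mul_le s τ hs i (4 * ε / τ) q ht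
    rw [← hexp]
    refine le_of_mul_le_mul_right (h.trans ?_) (Real.exp_pos (4 * ε / τ * q))
    rw [mul_pow, ← Real.exp_nat_mul, mul_assoc, ← Real.exp_add]
    gcongr
    have h1 : 4 * ε / τ * ((τ : ℝ) / s + ε) ≤ 4 * ε / τ * q := by gcongr
    have h2 : (τ : ℝ) * (4 * ε / τ / s + (4 * ε / τ) ^ 2 / 8) = -L + 4 * ε / τ * ((τ : ℝ) / s + ε) := by
      have h3 : L = 2 * ε ^ 2 / τ := by rw [hε2]; field_simp
      rw [h3]; field_simp; ring
    linarith
  rw [div_le_iff₀ (by positivity), Nat.card_eq_fintype_card, Fintype.card_subtype]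
  have hsub : (Finset.univ.filter fun f : Fin τ → Fin s => ∃ i : Fin s,
        q ≤ ((Finset.univ.filter fun j => f j = i).card : ℝ)) ⊆
      Finset.univ.biUnion fun i : Fin s => Finset.univ.filter fun f : Fin τ → Fin s =>
        q ≤ ((Finset.univ.filter fun j => f j = i).card : ℝ) := by
    intro f hf
    simpa using hf
  have hc := (Finset.card_le_card hsub).trans Finset.card_biUnion_le
  calc _ ≤ ((∑ i : Fin s, (Finset.univ.filter fun f : Fin τ → Fin s =>
        q ≤ ((Finset.univ.filter fun j => f j = i).card : ℝ)).card : ℕ) : ℝ) := by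
          exact_mod_cast hc
    _ ≤ ∑ i : Fin s, (s : ℝ) ^ τ * ((2 : ℝ) ^ (-σ) / s) := by
          push_cast
          exact Finset.sum_le_sum fun i _ => hone i
    _ = _ := by
          simp
          field_simp
end
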